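/- Let u₀ : [0,1] → S² ⊂ ℝ³ be a smooth map satisfying the compatibility condition C̃C(k) for every k ≥ 0. Then there exists a time T₁ > 0 and a unique smooth map u : [0,1] × [0,T₁] → ℝ³ with |u(x,t)| = 1 everywhere, satisfying ∂_t u = u × ∂_x²u on [0,1] × [0,T₁], the Neumann boundary conditions ∂_x u(0,t) = ∂_x u(1,t) = 0 for all t ∈ [0,T₁], and u(·,0) = u₀. -/

import Mathlib

open MeasureTheory Set

noncomputable section

abbrev E3 := EuclideanSpace ℝ (Fin 3)

/-- The cross product on `EuclideanSpace ℝ (Fin 3)`. -/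
def cross3 (a b : E3) : E3 :=
  (WithLp.equiv 2 (Fin 3 → ℝ)).symm
    (crossProduct ((WithLp.equiv 2 (Fin 3 → ℝ)) a) ((WithLp.equiv 2 (Fin 3 → ℝ)) b))

/-- Partial derivative in the space variable of `u = u x t`. -/
def pdx (u : ℝ → ℝ → E3) : ℝ → ℝ → E3 := fun x t => deriv (fun y => u y t) x

/-- Partial derivative in the time variable of `u = u x t`. -/
def pdt (u : ℝ → ℝ → E3) : ℝ → ℝ → E3 := fun x t => deriv (fun s => u x s) t

/-- `u` is a smooth solution of the 1-dimensional Schrödinger flow with Neumann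
boundary conditions on `[0,1] × [0,T]`. -/
def IsSol (T : ℝ) (u : ℝ → ℝ → E3) : Prop :=
  ContDiff ℝ (⊤ : ℕ∞) (fun p : ℝ × ℝ => u p.1 p.2) ∧
  (∀ x ∈ Icc (0:ℝ) 1, ∀ t ∈ Icc (0:ℝ) T, ‖u x t‖ = 1) ∧
  (∀ x ∈ Icc (0:ℝ) 1, ∀ t ∈ Icc (0:ℝ) T, pdt u x t = cross3 (u x t) (pdx (pdx u) x t)) ∧
  (∀ t ∈ Icc (0:ℝ) T, pdx u 0 t = 0 ∧ pdx u 1 t = 0)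

/-- Squared `L²` norm on `[0,1]`. -/
def L2sq (f : ℝ → E3) : ℝ := ∫ x in (0:ℝ)..1, ‖f x‖ ^ 2

/-- Squared `H^k` Sobolev norm on `[0,1]`. -/
def Hsq (k : ℕ) (f : ℝ → E3) : ℝ :=
  ∑ j ∈ Finset.range (k + 1), ∫ x in (0:ℝ)..1, ‖deriv^[j] f x‖ ^ 2

/-- Covariant derivative along `u₀` of a vector field `V`. -/
def covD (u₀ V : ℝ → E3) : ℝ → E3 :=
  fun x => deriv V x - (inner ℝ (deriv V x) (u₀ x) : ℝ) • u₀ x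

/-- `covIter u₀ j = ∇̃ₓ^(j+1) u₀`: iterated covariant derivatives of `u₀`. -/
def covIter (u₀ : ℝ → E3) : ℕ → ℝ → E3
  | 0 => fun x => deriv u₀ x
  | (j+1) => covD u₀ (covIter u₀ j)

/-- The compatibility condition `C̃C(k)`: `∇̃ₓ^(2j+1) u₀` vanishes at both endpoints
for all `0 ≤ j ≤ k`. -/
def CC (u₀ : ℝ → E3) (k : ℕ) : Prop :=
  ∀ j ≤ k, covIter u₀ (2 * j) 0 = 0 ∧ covIter u₀ (2 * j) 1 = 0

section LinearODE

variable {E : Type*} [NormedAddCommGroup E] [NormedSpace ℝ E]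

/-- A linear ODE with continuous coefficients is uniquely solvable on open intervals. -/
theorem linearODE_unique_Ioo {A : ℝ → E →L[ℝ] E} (hA : Continuous A) {R : ℝ} (hR : 0 < R)
    {Y Z : ℝ → E}
    (hY : ∀ t ∈ Ioo (-R) R, HasDerivAt Y (A t (Y t)) t)
    (hZ : ∀ t ∈ Ioo (-R) R, HasDerivAt Z (A t (Z t)) t) (h0 : Y 0 = Z 0) :
    EqOn Y Z (Ioo (-R) R) := by
  obtain ⟨K, hK⟩ := isCompact_Icc.exists_bound_of_continuousOn (s := Icc (-R) R) hA.continuousOn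
  refine ODE_solution_unique_of_mem_Ioo (v := fun t y => A t y) (s := fun _ => univ)
    (K := K.toNNReal) (t₀ := 0) (fun t ht => ?_) ⟨by linarith, hR⟩
    (fun t ht => ⟨hY t ht, trivial⟩) (fun t ht => ⟨hZ t ht, trivial⟩) h0
  have h1 : ‖A t‖₊ ≤ K.toNNReal := by
    rw [← NNReal.coe_le_coe]
    exact (hK t (Ioo_subset_Icc_self ht)).trans (Real.le_coe_toNNReal K)
  exact ((A t).lipschitz.weaken h1).lipschitzOnWith

variable [FiniteDimensional ℝ E]

theorem linearODE_exists_Icc {A : ℝ → E →L[ℝ] E} (hA : Continuous A) {R : ℝ} (hR : 0 < R)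
    (y₀ : E) :
    ∃ Y : ℝ → E, Y 0 = y₀ ∧
      ∀ t ∈ Ioo (-R) R, HasDerivAt Y (A t (Y t)) t := by
  have : CompleteSpace E := FiniteDimensional.complete ℝ E
  obtain ⟨K, hK⟩ := isCompact_Icc.exists_bound_of_continuousOn (s := Icc (-R) R) hA.continuousOn
  have hK0 : 0 ≤ K := (norm_nonneg _).trans (hK 0 ⟨by linarith, hR.le⟩)
  set M : ℝ := ‖y₀‖ * Real.exp (K * R) + 1 with hM
  have hM0 : 0 < M := by positivity
  let χ : ContDiffBump (0 : E) := ⟨M, M + 1, hM0, by linarith⟩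
  let g : E → E := fun y => χ y • y
  have hg : ContDiff ℝ 1 g := χ.contDiff.smul contDiff_id
  have hgc : HasCompactSupport g := χ.hasCompactSupport.smul_right
  obtain ⟨C, hC⟩ := hg.lipschitzWith_of_hasCompactSupport hgc (by simp)
  obtain ⟨D, hD⟩ := hgc.exists_bound_of_continuous hg.continuous
  have hD0 : 0 ≤ D := (norm_nonneg _).trans (hD 0)
  have hgle : ∀ y, ‖g y‖ ≤ ‖y‖ := fun y => by
    simp only [g, norm_smul, Real.norm_eq_abs, abs_of_nonneg χ.nonneg]
    exact mul_le_of_le_one_left (norm_nonneg _) χ.le_one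
  have h0 : (0 : ℝ) ∈ Icc (-R) R := ⟨by linarith, hR.le⟩
  have hPL : IsPicardLindelof (fun t y => A t (g y)) (⟨0, h0⟩ : Icc (-R) R) y₀
      (K * D * R).toNNReal 0 (K * D).toNNReal (K.toNNReal * C) := by
    refine ⟨fun t ht => ?_, fun x _ => ?_, fun t ht x _ => ?_, ?_⟩
    · have h1 : ‖A t‖₊ ≤ K.toNNReal := by
        rw [← NNReal.coe_le_coe]
        exact (hK t ht).trans (Real.le_coe_toNNReal K)
      exact (((A t).lipschitz.weaken h1).comp hC).lipschitzOnWith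
    · exact (hA.clm_apply continuous_const).continuousOn
    · rw [Real.coe_toNNReal _ (by positivity)]
      exact ((A t).le_opNorm _).trans (mul_le_mul (hK t ht) (hD x) (norm_nonneg _) hK0)
    · rw [Real.coe_toNNReal _ (by positivity), Real.coe_toNNReal _ (by positivity)]
      simp
  obtain ⟨Y, hY0, hY⟩ := hPL.exists_eq_forall_mem_Icc_hasDerivWithinAt₀
  have hYc : ContinuousOn Y (Icc (-R) R) := fun t ht => (hY t ht).continuousWithinAt
  have hY' : ∀ t ∈ Ioo (-R) R, HasDerivAt Y (A t (g (Y t))) t := fun t ht =>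
    (hY t (Ioo_subset_Icc_self ht)).hasDerivAt (Icc_mem_nhds ht.1 ht.2)
  have hgY : ∀ t ∈ Icc (-R) R, ‖A t (g (Y t))‖ ≤ K * ‖Y t‖ + 0 := fun t ht => by
    rw [add_zero]
    exact ((A t).le_opNorm _).trans (mul_le_mul (hK t ht) (hgle _) (norm_nonneg _) hK0)
  have hfwd : ∀ t ∈ Icc 0 R, ‖Y t‖ ≤ gronwallBound ‖y₀‖ K 0 (t - 0) := by
    refine norm_le_gronwallBound_of_norm_deriv_right_le (f' := fun t => A t (g (Y t)))
      (hYc.mono (Icc_subset_Icc (by linarith) le_rfl)) (fun t ht => ?_) (by simp [← hY0])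
      (fun t ht => hgY t ⟨by linarith [ht.1], ht.2.le⟩)
    exact (hY' t ⟨by linarith [ht.1], ht.2⟩).hasDerivWithinAt
  have hbwd : ∀ t ∈ Icc 0 R, ‖Y (-t)‖ ≤ gronwallBound ‖y₀‖ K 0 (t - 0) := by
    refine norm_le_gronwallBound_of_norm_deriv_right_le (f := fun t => Y (-t))
      (f' := fun t => -A (-t) (g (Y (-t)))) (hYc.comp continuous_neg.continuousOn
        fun t ht => ⟨by linarith [ht.2], by linarith [ht.1]⟩) (fun t ht => ?_) (by simp [← hY0])
      (fun t ht => ?_)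
    · have := (hY' (-t) ⟨by linarith [ht.2], by linarith [ht.1]⟩).scomp t (hasDerivAt_neg t)
      simpa [Function.comp_def] using this.hasDerivWithinAt
    · simpa using hgY (-t) ⟨by linarith [ht.2], by linarith [ht.1]⟩
  have hbd : ∀ t ∈ Icc (-R) R, ‖Y t‖ ≤ M := by
    have key : ∀ t ∈ Icc 0 R, gronwallBound ‖y₀‖ K 0 (t - 0) ≤ M := fun t ht => by
      rw [gronwallBound_ε0, sub_zero, hM]
      have : Real.exp (K * t) ≤ Real.exp (K * R) := by
        gcongr; exact ht.2
      nlinarith [norm_nonneg y₀]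
    intro t ht
    rcases le_total 0 t with h | h
    · exact (hfwd t ⟨h, ht.2⟩).trans (key t ⟨h, ht.2⟩)
    · have h2 : -t ∈ Icc 0 R := ⟨by linarith, by linarith [ht.1]⟩
      simpa using (hbwd (-t) h2).trans (key (-t) h2)
  refine ⟨Y, hY0, fun t ht => ?_⟩
  have : g (Y t) = Y t := by
    have : χ (Y t) = 1 := χ.one_of_mem_closedBall
      (by simpa [χ] using hbd t (Ioo_subset_Icc_self ht))
    simp [g, this]
  simpa [this] using hY' t ht

/-- Global solvability of linear ODEs with continuous coefficients. -/
theorem linearODE_exists {A : ℝ → E →L[ℝ] E} (hA : Continuous A) (y₀ : E) :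
    ∃ Y : ℝ → E, Y 0 = y₀ ∧ ∀ t, HasDerivAt Y (A t (Y t)) t := by
  choose Y hY0 hY using fun n : ℝ =>
    linearODE_exists_Icc hA (R := |n| + 1) (by positivity) y₀
  have key : ∀ r s t : ℝ, |t| < |r| + 1 → |r| ≤ |s| → Y s t = Y r t := fun r s t ht hrs => by
    have hsub : Ioo (-(|r| + 1)) (|r| + 1) ⊆ Ioo (-(|s| + 1)) (|s| + 1) :=
      Ioo_subset_Ioo (by linarith) (by linarith)
    exact linearODE_unique_Ioo hA (by positivity) (fun t ht => hY s t (hsub ht)) (hY r)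
      ((hY0 s).trans (hY0 r).symm) (abs_lt.1 ht)
  refine ⟨fun t => Y t t, hY0 0, fun t => ?_⟩
  have hev : (fun s => Y s s) =ᶠ[nhds t] Y (|t| + 1) := by
    have : ∀ᶠ s in nhds t, |s| < |t| + 1 :=
      (continuous_abs.tendsto t).eventually (gt_mem_nhds (by linarith))
    filter_upwards [this] with s hs
    refine (key s (|t| + 1) s (by linarith) ?_).symm
    rw [abs_of_nonneg (by positivity : 0 ≤ |t| + 1)]; exact hs.le
  have hh : (|t| + 1 : ℝ) = |(|t| + 1)| := (abs_of_nonneg (by positivity)).symm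
  have h1 := hY (|t| + 1) t (abs_lt.1 (by rw [← hh]; linarith))
  have h2 : Y (|t| + 1) t = Y t t := hev.symm.eq_of_nhds
  rw [h2] at h1
  exact h1.congr_of_eventuallyEq hev

end LinearODE

section Partials

variable {F : Type*} [NormedAddCommGroup F] [NormedSpace ℝ F]

/-- A function on an open subset of the plane whose two partial derivatives are continuous is
differentiable. -/
theorem hasFDerivAt_of_partials {U : Set (ℝ × ℝ)} (hU : IsOpen U) {f g h : ℝ × ℝ → F}
    (hg : ContinuousOn g U) (hh : ContinuousOn h U)
    (hx : ∀ p ∈ U, HasDerivAt (fun x => f (x, p.2)) (g p) p.1)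
    (ht : ∀ p ∈ U, HasDerivAt (fun t => f (p.1, t)) (h p) p.2) {p : ℝ × ℝ} (hp : p ∈ U) :
    HasFDerivAt f ((ContinuousLinearMap.toSpanSingleton ℝ (g p)).coprod
      (ContinuousLinearMap.toSpanSingleton ℝ (h p))) p := by
  have hc : Continuous fun v : F => ContinuousLinearMap.toSpanSingleton ℝ v :=
    (ContinuousLinearMap.toSpanSingletonCLE (𝕜 := ℝ) (E := F)).continuous
  have hev : ∀ᶠ v in nhds p, v ∈ U := hU.mem_nhds hp
  have := hasStrictFDerivAt_uncurry_coprod (𝕜 := ℝ) (u := p) (f := fun x t => f (x, t))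
    (f₁ := fun x t => ContinuousLinearMap.toSpanSingleton ℝ (g (x, t)))
    (f₂ := fun x t => ContinuousLinearMap.toSpanSingleton ℝ (h (x, t)))
    (hev.mono fun v hv => (hx v hv).hasFDerivAt) (hev.mono fun v hv => (ht v hv).hasFDerivAt)
    (hc.continuousAt.comp (hg.continuousAt (hU.mem_nhds hp)))
    (hc.continuousAt.comp (hh.continuousAt (hU.mem_nhds hp)))
  exact this.hasFDerivAt

theorem contDiffOn_succ_of_partials {U : Set (ℝ × ℝ)} (hU : IsOpen U) {f g h : ℝ × ℝ → F} {n : ℕ}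
    (hg : ContDiffOn ℝ n g U) (hh : ContDiffOn ℝ n h U)
    (hx : ∀ p ∈ U, HasDerivAt (fun x => f (x, p.2)) (g p) p.1)
    (ht : ∀ p ∈ U, HasDerivAt (fun t => f (p.1, t)) (h p) p.2) :
    ContDiffOn ℝ (n + 1 : ℕ) f U := by
  have hfd := fun p hp =>
    hasFDerivAt_of_partials hU hg.continuousOn hh.continuousOn hx ht (p := p) hp
  have hL : ContDiff ℝ n fun v : F => ContinuousLinearMap.toSpanSingleton ℝ v :=
    (ContinuousLinearMap.toSpanSingletonCLE (𝕜 := ℝ) (E := F)).contDiff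
  push_cast
  rw [contDiffOn_succ_iff_fderiv_of_isOpen hU]
  refine ⟨fun p hp => (hfd p hp).differentiableAt.differentiableWithinAt, by simp, ?_⟩
  refine ContDiffOn.congr ?_ fun p hp => (hfd p hp).fderiv
  have h1 := (hL.comp_contDiffOn hg)
  have h2 := (hL.comp_contDiffOn hh)
  have h3 : ∀ p, (ContinuousLinearMap.toSpanSingleton ℝ (g p)).coprod
      (ContinuousLinearMap.toSpanSingleton ℝ (h p)) =
      (ContinuousLinearMap.toSpanSingleton ℝ (g p)).comp (ContinuousLinearMap.fst ℝ ℝ ℝ) +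
      (ContinuousLinearMap.toSpanSingleton ℝ (h p)).comp (ContinuousLinearMap.snd ℝ ℝ ℝ) := by
    intro p; ext <;> simp
  simp_rw [h3]
  exact (h1.clm_comp contDiffOn_const).add (h2.clm_comp contDiffOn_const)

end Partials

section Flat

variable {E : Type*} [NormedAddCommGroup E] [NormedSpace ℝ E]

theorem gronwallBound_smul (c δ K ε x : ℝ) :
    gronwallBound (c * δ) K (c * ε) x = c * gronwallBound δ K ε x := by
  unfold gronwallBound
  split_ifs <;> ring

/-- A two-sided Grönwall inequality. -/
theorem norm_le_gronwallBound_abs {d d' : ℝ → E} {S δ K ε : ℝ}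
    (hd : ∀ t ∈ Ioo (-S) S, HasDerivAt d (d' t) t) (h0 : ‖d 0‖ ≤ δ)
    (hb : ∀ t ∈ Ioo (-S) S, ‖d' t‖ ≤ K * ‖d t‖ + ε) :
    ∀ t ∈ Ioo (-S) S, ‖d t‖ ≤ gronwallBound δ K ε |t| := by
  have key : ∀ {d d' : ℝ → E}, (∀ t ∈ Ioo (-S) S, HasDerivAt d (d' t) t) → ‖d 0‖ ≤ δ →
      (∀ t ∈ Ioo (-S) S, ‖d' t‖ ≤ K * ‖d t‖ + ε) →
      ∀ t ∈ Ico 0 S, ‖d t‖ ≤ gronwallBound δ K ε t := by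
    intro d d' hd h0 hb t ht
    have hsub : ∀ s ∈ Icc 0 t, s ∈ Ioo (-S) S := fun s hs =>
      ⟨by linarith [hs.1, ht.1, ht.2], by linarith [hs.2, ht.2]⟩
    have := norm_le_gronwallBound_of_norm_deriv_right_le (f := d) (f' := d') (a := 0) (b := t)
      (fun s hs => (hd s (hsub s hs)).continuousAt.continuousWithinAt)
      (fun s hs => (hd s (hsub s ⟨hs.1, hs.2.le⟩)).hasDerivWithinAt) h0
      (fun s hs => hb s (hsub s ⟨hs.1, hs.2.le⟩)) t ⟨ht.1, le_rfl⟩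
    simpa using this
  intro t ht
  rcases le_total 0 t with h | h
  · rw [abs_of_nonneg h]
    exact key hd h0 hb t ⟨h, ht.2⟩
  · rw [abs_of_nonpos h]
    have := key (d := fun t => d (-t)) (d' := fun t => -d' (-t)) (fun s hs => ?_)
      (by simpa using h0)
      (fun s hs => ?_) (-t) ⟨by linarith, by linarith [ht.1]⟩
    · simpa using this
    · have := (hd (-s) ⟨by linarith [hs.2], by linarith [hs.1]⟩).scomp s (hasDerivAt_neg s)
      simpa [Function.comp_def] using this
    · simpa using hb (-s) ⟨by linarith [hs.2], by linarith [hs.1]⟩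

/-- Differentiability in the first variable, uniform for the second one in a compact set. -/
theorem eventually_norm_taylor_le {F : Type*} [NormedAddCommGroup F] [NormedSpace ℝ F]
    {B Bx : ℝ × ℝ → F} {U : Set (ℝ × ℝ)} (hU : IsOpen U) {K : Set ℝ} (hK : IsCompact K) {x₀ : ℝ}
    (hKU : ∀ t ∈ K, ∀ x, (x, t) ∈ U) (hBx : ContinuousOn Bx U)
    (hB : ∀ p ∈ U, HasDerivAt (fun x => B (x, p.2)) (Bx p) p.1) {ε : ℝ} (hε : 0 < ε) :
    ∀ᶠ x in nhds x₀, ∀ t ∈ K,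
      ‖B (x, t) - B (x₀, t) - (x - x₀) • Bx (x₀, t)‖ ≤ ε * |x - x₀| := by
  have h1 : ∀ᶠ x in nhds x₀, ∀ t ∈ K, ‖Bx (x, t) - Bx (x₀, t)‖ < ε := by
    refine hK.eventually_forall_of_forall_eventually fun t ht => ?_
    have hc : ContinuousAt Bx (x₀, t) := hBx.continuousAt (hU.mem_nhds (hKU t ht x₀))
    have hc2 : ContinuousAt (fun z : ℝ × ℝ => Bx z - Bx (x₀, z.2)) (x₀, t) := by
      refine hc.sub ?_
      have hc' : ContinuousAt Bx ((fun z : ℝ × ℝ => (x₀, z.2)) (x₀, t)) := hc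
      exact hc'.comp (f := fun z : ℝ × ℝ => (x₀, z.2)) (by fun_prop)
    have := hc2.norm.eventually_lt (continuousAt_const (y := ε)) (by simpa using hε)
    simpa using this
  obtain ⟨r, hr, hball⟩ := Metric.eventually_nhds_iff_ball.1 h1
  filter_upwards [Metric.ball_mem_nhds x₀ hr] with x hx t ht
  have := (convex_ball x₀ r).norm_image_sub_le_of_norm_hasDerivWithin_le
    (f := fun y => B (y, t) - (y - x₀) • Bx (x₀, t))
    (f' := fun y => Bx (y, t) - Bx (x₀, t)) (C := ε)
    (fun y hy => ?_) (fun y hy => (hball y hy t ht).le) (Metric.mem_ball_self hr) hx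
  · simp only [sub_self, zero_smul, sub_zero] at this
    rw [Real.norm_eq_abs] at this
    convert this using 2
    abel
  · have h2 := ((hasDerivAt_id y).sub_const x₀).smul_const (Bx (x₀, t))
    rw [one_smul] at h2
    exact ((hB (y, t) (hKU t ht y)).sub h2).hasDerivWithinAt

/-- If `∂ₜ Y = B Y` for all `x`, if `∂ₓ Y = A Y` at time zero and if the connection `(A, B)` is
flat, then `∂ₓ Y = A Y` at all times. -/
theorem flat_hasDerivAt_fst {T : ℝ} {A B At Bx : ℝ × ℝ → E →L[ℝ] E} {Y : ℝ × ℝ → E}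
    (hB : ContinuousOn B (univ ×ˢ Ioo (-T) T)) (hBx : ContinuousOn Bx (univ ×ˢ Ioo (-T) T))
    (hA : ContinuousOn A (univ ×ˢ Ioo (-T) T))
    (hAt : ∀ p ∈ (univ ×ˢ Ioo (-T) T : Set (ℝ × ℝ)), HasDerivAt (fun t => A (p.1, t)) (At p) p.2)
    (hBx' : ∀ p ∈ (univ ×ˢ Ioo (-T) T : Set (ℝ × ℝ)), HasDerivAt (fun x => B (x, p.2)) (Bx p) p.1)
    (hflat : ∀ p ∈ (univ ×ˢ Ioo (-T) T : Set (ℝ × ℝ)),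
      At p + (A p).comp (B p) = Bx p + (B p).comp (A p))
    (hYt : ∀ p ∈ (univ ×ˢ Ioo (-T) T : Set (ℝ × ℝ)),
      HasDerivAt (fun t => Y (p.1, t)) (B p (Y p)) p.2)
    (hY0 : ∀ x, HasDerivAt (fun x => Y (x, 0)) (A (x, 0) (Y (x, 0))) x) :
    ∀ p ∈ (univ ×ˢ Ioo (-T) T : Set (ℝ × ℝ)), HasDerivAt (fun x => Y (x, p.2)) (A p (Y p)) p.1 := by
  rintro ⟨x₀, t₀⟩ ⟨-, ht₀⟩
  have hU : IsOpen (univ ×ˢ Ioo (-T) T : Set (ℝ × ℝ)) := isOpen_univ.prod isOpen_Ioo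
  obtain ⟨S, hS1, hS2⟩ : ∃ S, |t₀| < S ∧ S < T := exists_between (abs_lt.2 ht₀)
  have hS0 : 0 < S := (abs_nonneg _).trans_lt hS1
  have hKU : ∀ t ∈ Icc (-S) S, ∀ x : ℝ, (x, t) ∈ (univ ×ˢ Ioo (-T) T : Set (ℝ × ℝ)) :=
    fun t ht x => ⟨trivial, by linarith [ht.1], by linarith [ht.2]⟩
  have hcomp : ∀ x : ℝ, ContinuousOn (fun t : ℝ => (x, t)) (Icc (-S) S) := fun x => by fun_prop
  have hYc : ContinuousOn (fun t => Y (x₀, t)) (Icc (-S) S) := fun t ht =>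
    (hYt (x₀, t) (hKU t ht x₀)).continuousAt.continuousWithinAt
  have hAc : ContinuousOn (fun t => A (x₀, t)) (Icc (-S) S) :=
    hA.comp (hcomp x₀) fun t ht => hKU t ht x₀
  have hBc : ContinuousOn (fun t => B (x₀, t)) (Icc (-S) S) :=
    hB.comp (hcomp x₀) fun t ht => hKU t ht x₀
  have hBxc : ContinuousOn (fun t => Bx (x₀, t)) (Icc (-S) S) :=
    hBx.comp (hcomp x₀) fun t ht => hKU t ht x₀
  obtain ⟨CY, hCY⟩ := isCompact_Icc.exists_bound_of_continuousOn hYc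
  obtain ⟨CA, hCA⟩ := isCompact_Icc.exists_bound_of_continuousOn (hAc.clm_apply hYc)
  obtain ⟨CB, hCB⟩ := isCompact_Icc.exists_bound_of_continuousOn hBc
  obtain ⟨CX, hCX⟩ := isCompact_Icc.exists_bound_of_continuousOn hBxc
  have hzero : (0 : ℝ) ∈ Icc (-S) S := ⟨by linarith, hS0.le⟩
  have hCY0 := (norm_nonneg _).trans (hCY 0 hzero)
  have hCA0 := (norm_nonneg _).trans (hCA 0 hzero)
  have hCX0 := (norm_nonneg _).trans (hCX 0 hzero)
  set G := gronwallBound 1 (CB + (1 + CX)) (CY + CA) |t₀| with hG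
  rw [hasDerivAt_iff_isLittleO]
  rw [Asymptotics.isLittleO_iff]
  intro c hc
  obtain ⟨ε, hε, hε1, hεc⟩ : ∃ ε > 0, ε ≤ 1 ∧ ε * G ≤ c := by
    rcases le_or_gt G 0 with h | h
    · exact ⟨1, one_pos, le_rfl, by linarith⟩
    · refine ⟨min 1 (c / G), lt_min one_pos (by positivity), min_le_left _ _, ?_⟩
      calc min 1 (c / G) * G ≤ c / G * G := by gcongr; exact min_le_right _ _
        _ = c := by field_simp
  have e1 := eventually_norm_taylor_le (x₀ := x₀) hU isCompact_Icc hKU hBx hBx' hε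
  have e2 := (Asymptotics.isLittleO_iff.1 (hasDerivAt_iff_isLittleO.1 (hY0 x₀))) hε
  have e3 : ∀ᶠ x in nhds x₀, (1 + CX) * |x - x₀| < min ε 1 := by
    have : Continuous fun x => (1 + CX) * |x - x₀| := by fun_prop
    exact this.continuousAt.eventually_lt continuousAt_const (by simpa using hε)
  filter_upwards [e1, e2, e3] with x h1 h2 h3
  set h := x - x₀ with hh
  have hBd : ∀ t ∈ Icc (-S) S, ‖B (x, t) - B (x₀, t)‖ ≤ (1 + CX) * |h| := fun t ht => by
    have := norm_add_le (B (x, t) - B (x₀, t) - h • Bx (x₀, t)) (h • Bx (x₀, t))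
    rw [sub_add_cancel, norm_smul, Real.norm_eq_abs] at this
    nlinarith [h1 t ht, hCX t ht, abs_nonneg h]
  have hmain := norm_le_gronwallBound_abs (S := S) (δ := ε * |h| * 1) (K := CB + (1 + CX))
    (ε := ε * |h| * (CY + CA))
    (d := fun t => Y (x, t) - (Y (x₀, t) + h • A (x₀, t) (Y (x₀, t))))
    (d' := fun t => B (x, t) (Y (x, t)) - (B (x₀, t) (Y (x₀, t)) +
      h • (At (x₀, t) (Y (x₀, t)) + A (x₀, t) (B (x₀, t) (Y (x₀, t))))))
    (fun t ht => ?_) ?_ (fun t ht => ?_) t₀ (abs_lt.1 hS1)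
  · rw [gronwallBound_smul] at hmain
    have : ε * |h| * G ≤ c * |h| := by nlinarith [abs_nonneg h]
    rw [Real.norm_eq_abs]
    calc _ = ‖Y (x, t₀) - (Y (x₀, t₀) + h • A (x₀, t₀) (Y (x₀, t₀)))‖ := by
          rw [sub_sub]
      _ ≤ _ := hmain.trans this
  · have htU := hKU t (Ioo_subset_Icc_self ht)
    exact (hYt _ (htU x)).sub ((hYt _ (htU x₀)).add
      (((hAt _ (htU x₀)).clm_apply (hYt _ (htU x₀))).const_smul h))
  · rw [mul_one, ← sub_sub]
    simpa using h2
  · have ht' := Ioo_subset_Icc_self ht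
    have hfl := DFunLike.congr_fun (hflat _ (hKU t ht' x₀)) (Y (x₀, t))
    simp only [add_apply, ContinuousLinearMap.comp_apply] at hfl
    rw [hfl]
    set y := Y (x₀, t)
    set w := Y (x, t) - (y + h • A (x₀, t) y)
    have hw : Y (x, t) = w + (y + h • A (x₀, t) y) := by simp [w]
    have hid : B (x, t) (Y (x, t)) - (B (x₀, t) y +
        h • (Bx (x₀, t) y + B (x₀, t) (A (x₀, t) y))) =
        B (x, t) w + (B (x, t) - B (x₀, t) - h • Bx (x₀, t)) y +
          h • (B (x, t) - B (x₀, t)) (A (x₀, t) y) := by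
      rw [hw]
      simp only [map_add, map_smul, sub_apply, smul_apply,
        smul_add, smul_sub]
      abel
    rw [hid]
    have b1 : ‖B (x, t)‖ ≤ CB + (1 + CX) := by
      have := norm_add_le (B (x, t) - B (x₀, t)) (B (x₀, t))
      rw [sub_add_cancel] at this
      have h4 : (1 + CX) * |h| ≤ 1 := (h3.trans_le (min_le_right _ _)).le
      linarith [hBd t ht', hCB t ht']
    have b2 := (B (x, t)).le_of_opNorm_le b1 w
    have b3 := (B (x, t) - B (x₀, t) - h • Bx (x₀, t)).le_of_opNorm_le (h1 t ht') y
    have b4 := (B (x, t) - B (x₀, t)).le_of_opNorm_le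
      ((hBd t ht').trans (h3.trans_le (min_le_left _ _)).le) (A (x₀, t) y)
    refine (norm_add₃_le).trans ?_
    rw [norm_smul, Real.norm_eq_abs]
    have b5 : ε * |h| * ‖y‖ ≤ ε * |h| * CY := by gcongr; exact hCY t ht'
    have b6 : |h| * (ε * ‖A (x₀, t) y‖) ≤ |h| * (ε * CA) := by gcongr; exact hCA t ht'
    have b7 := mul_le_mul_of_nonneg_left b4 (abs_nonneg h)
    nlinarith

theorem contDiffOn_of_flat {U : Set (ℝ × ℝ)} (hU : IsOpen U) {A B : ℝ × ℝ → E →L[ℝ] E}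
    {Y : ℝ × ℝ → E} (hA : ContDiffOn ℝ (⊤ : ℕ∞) A U) (hB : ContDiffOn ℝ (⊤ : ℕ∞) B U)
    (hYc : ContinuousOn Y U)
    (hYx : ∀ p ∈ U, HasDerivAt (fun x => Y (x, p.2)) (A p (Y p)) p.1)
    (hYt : ∀ p ∈ U, HasDerivAt (fun t => Y (p.1, t)) (B p (Y p)) p.2) :
    ContDiffOn ℝ (⊤ : ℕ∞) Y U := by
  rw [contDiffOn_infty]
  intro n
  induction n with
  | zero => simpa using hYc
  | succ n ih =>
    have hn : ((n : ℕ) : WithTop ℕ∞) ≤ ((⊤ : ℕ∞) : WithTop ℕ∞) := by exact_mod_cast le_top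
    exact contDiffOn_succ_of_partials hU ((hA.of_le hn).clm_apply ih) ((hB.of_le hn).clm_apply ih)
      hYx hYt

theorem continuousOn_of_linear_partials {U : Set (ℝ × ℝ)} (hU : IsOpen U) {A : ℝ × ℝ → E →L[ℝ] E}
    {Y Yt : ℝ × ℝ → E} (hA : ContinuousOn A U)
    (hYx : ∀ p ∈ U, HasDerivAt (fun x => Y (x, p.2)) (A p (Y p)) p.1)
    (hYt : ∀ p ∈ U, HasDerivAt (fun t => Y (p.1, t)) (Yt p) p.2) :
    ContinuousOn Y U := by
  rintro ⟨x₀, t₀⟩ hp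
  refine ContinuousAt.continuousWithinAt ?_
  have hAc : ContinuousAt A (x₀, t₀) := hA.continuousAt (hU.mem_nhds hp)
  have hYc : ContinuousAt (fun t => Y (x₀, t)) t₀ := (hYt _ hp).continuousAt
  set K := ‖A (x₀, t₀)‖ + 1
  set C := ‖Y (x₀, t₀)‖ + 1
  have ev1 : ∀ᶠ p in nhds (x₀, t₀), p ∈ U ∧ ‖A p‖ < K :=
    (hU.eventually_mem hp).and (hAc.norm.eventually_lt continuousAt_const (by simp [K]))
  have ev2 : ∀ᶠ t in nhds t₀, ‖Y (x₀, t)‖ < C :=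
    hYc.norm.eventually_lt continuousAt_const (by simp [C])
  obtain ⟨δ, hδ, h1⟩ := Metric.eventually_nhds_iff.1 ev1
  have hbound : ∀ᶠ p in nhds (x₀, t₀),
      ‖Y p - Y (x₀, p.2)‖ ≤ gronwallBound 0 K (K * C) |p.1 - x₀| := by
    have ev3 : ∀ᶠ p : ℝ × ℝ in nhds (x₀, t₀), ‖Y (x₀, p.2)‖ < C :=
      (continuous_snd.tendsto (x₀, t₀)).eventually ev2
    filter_upwards [Metric.ball_mem_nhds (x₀, t₀) hδ, ev3] with p hpδ hpC
    rw [Metric.mem_ball, Prod.dist_eq, max_lt_iff, Real.dist_eq, Real.dist_eq] at hpδ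
    have hin : ∀ s ∈ Ioo (-δ) δ, ((x₀ + s, p.2) ∈ U ∧ ‖A (x₀ + s, p.2)‖ < K) := fun s hs => by
      apply h1
      rw [Prod.dist_eq, max_lt_iff, Real.dist_eq, Real.dist_eq]
      exact ⟨by simpa using abs_lt.2 hs, hpδ.2⟩
    have := norm_le_gronwallBound_abs (S := δ) (δ := 0) (K := K) (ε := K * C)
      (d := fun s => Y (x₀ + s, p.2) - Y (x₀, p.2))
      (d' := fun s => A (x₀ + s, p.2) (Y (x₀ + s, p.2)))
      (fun s hs => by
        have := (hYx _ (hin s hs).1).comp_const_add x₀ s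
        exact this.sub_const _) (by simp) (fun s hs => by
        have h2 := (A (x₀ + s, p.2)).le_of_opNorm_le (hin s hs).2.le (Y (x₀ + s, p.2))
        have h3 := norm_add_le (Y (x₀ + s, p.2) - Y (x₀, p.2)) (Y (x₀, p.2))
        rw [sub_add_cancel] at h3
        have hK : 0 ≤ K := by positivity
        nlinarith) (p.1 - x₀) (abs_lt.1 hpδ.1)
    simpa using this
  have hz : Filter.Tendsto (fun p : ℝ × ℝ => Y p - Y (x₀, p.2)) (nhds (x₀, t₀)) (nhds 0) := by
    refine squeeze_zero_norm' hbound ?_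
    have hgc : Continuous fun x => gronwallBound 0 K (K * C) x := continuous_iff_continuousAt.2
      fun x => (hasDerivAt_gronwallBound _ _ _ x).continuousAt
    have : Continuous fun p : ℝ × ℝ => gronwallBound 0 K (K * C) |p.1 - x₀| := by fun_prop
    simpa [gronwallBound_x0] using this.tendsto (x₀, t₀)
  have hl : Filter.Tendsto (fun p : ℝ × ℝ => Y (x₀, p.2)) (nhds (x₀, t₀)) (nhds (Y (x₀, t₀))) :=
    hYc.tendsto.comp (continuous_snd.tendsto (x₀, t₀))
  simpa [ContinuousAt] using hz.add hl

/-- A smooth flat connection on a strip has a smooth parallel section with prescribed value at the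
origin, on every smaller strip. -/
theorem exists_parallel_of_flat [FiniteDimensional ℝ E] {T S : ℝ} (hS : 0 < S) (hST : S < T)
    {A B At Bx : ℝ × ℝ → E →L[ℝ] E}
    (hA : ContDiffOn ℝ (⊤ : ℕ∞) A (univ ×ˢ Ioo (-T) T))
    (hB : ContDiffOn ℝ (⊤ : ℕ∞) B (univ ×ˢ Ioo (-T) T))
    (hBx : ContinuousOn Bx (univ ×ˢ Ioo (-T) T))
    (hAt : ∀ p ∈ (univ ×ˢ Ioo (-T) T : Set (ℝ × ℝ)), HasDerivAt (fun t => A (p.1, t)) (At p) p.2)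
    (hBx' : ∀ p ∈ (univ ×ˢ Ioo (-T) T : Set (ℝ × ℝ)), HasDerivAt (fun x => B (x, p.2)) (Bx p) p.1)
    (hflat : ∀ p ∈ (univ ×ˢ Ioo (-T) T : Set (ℝ × ℝ)),
      At p + (A p).comp (B p) = Bx p + (B p).comp (A p)) (y₀ : E) :
    ∃ Y : ℝ × ℝ → E, Y (0, 0) = y₀ ∧ ContDiffOn ℝ (⊤ : ℕ∞) Y (univ ×ˢ Ioo (-S) S) ∧
      (∀ p ∈ (univ ×ˢ Ioo (-S) S : Set (ℝ × ℝ)),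
        HasDerivAt (fun x => Y (x, p.2)) (A p (Y p)) p.1) ∧
      ∀ p ∈ (univ ×ˢ Ioo (-S) S : Set (ℝ × ℝ)),
        HasDerivAt (fun t => Y (p.1, t)) (B p (Y p)) p.2 := by
  have hA0 : Continuous fun x : ℝ => A (x, 0) := by
    rw [← continuousOn_univ]
    exact hA.continuousOn.comp (by fun_prop) fun x _ =>
      ⟨trivial, by simp; linarith, by simp; linarith⟩
  obtain ⟨y, hy0, hy⟩ := linearODE_exists hA0 y₀
  set c : ℝ → ℝ := fun t => max (-S) (min S t)
  have hc : Continuous c := by fun_prop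
  have hcm : ∀ t, c t ∈ Ioo (-T) T := fun t =>
    ⟨lt_max_of_lt_left (by linarith), max_lt (by linarith) (min_lt_of_left_lt hST)⟩
  have hBc : ∀ x : ℝ, Continuous fun t => B (x, c t) := fun x => by
    rw [← continuousOn_univ]
    exact hB.continuousOn.comp (by fun_prop) fun t _ => ⟨trivial, hcm t⟩
  choose Z hZ0 hZ using fun x => linearODE_exists (hBc x) (y x)
  set Y : ℝ × ℝ → E := fun p => Z p.1 p.2
  have hsub : (univ ×ˢ Ioo (-S) S : Set (ℝ × ℝ)) ⊆ univ ×ˢ Ioo (-T) T :=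
    prod_mono_right (Ioo_subset_Ioo (by linarith) (by linarith))
  have hYt : ∀ p ∈ (univ ×ˢ Ioo (-S) S : Set (ℝ × ℝ)),
      HasDerivAt (fun t => Y (p.1, t)) (B p (Y p)) p.2 := fun p hp => by
    have := hZ p.1 p.2
    rwa [show c p.2 = p.2 by simp [c, hp.2.1.le, hp.2.2.le]] at this
  have hU : IsOpen (univ ×ˢ Ioo (-S) S : Set (ℝ × ℝ)) := isOpen_univ.prod isOpen_Ioo
  have hYx := flat_hasDerivAt_fst (hB.continuousOn.mono hsub) (hBx.mono hsub)
    (hA.continuousOn.mono hsub) (fun p hp => hAt p (hsub hp)) (fun p hp => hBx' p (hsub hp))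
    (fun p hp => hflat p (hsub hp)) hYt (fun x => by simpa [Y, hZ0] using hy x)
  exact ⟨Y, by simp [Y, hZ0, hy0], contDiffOn_of_flat hU (hA.mono hsub) (hB.mono hsub)
    (continuousOn_of_linear_partials hU (hA.continuousOn.mono hsub) hYx hYt) hYx hYt, hYx, hYt⟩

end Flat

section Weight

/-- Power series with submultiplicative nonnegative coefficients define submultiplicative
weights. -/
theorem tsum_pow_div_factorial_add_le {ε : ℕ → ℝ} (h0 : ∀ k, 0 ≤ ε k) (h1 : ∀ k, ε k ≤ 1)
    (hε : ∀ j k, ε (j + k) ≤ ε j * ε k) {x y : ℝ} (hx : 0 ≤ x) (hy : 0 ≤ y) :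
    ∑' k, ε k * ((x + y) ^ k / k.factorial) ≤
      (∑' k, ε k * (x ^ k / k.factorial)) * ∑' k, ε k * (y ^ k / k.factorial) := by
  have hs : ∀ z : ℝ, 0 ≤ z → Summable fun k => ε k * (z ^ k / k.factorial) := fun z hz =>
    Summable.of_nonneg_of_le (fun k => mul_nonneg (h0 k) (by positivity))
      (fun k => mul_le_of_le_one_left (by positivity) (h1 k)) (Real.summable_pow_div_factorial z)
  have hn : ∀ z : ℝ, 0 ≤ z → Summable fun k => ‖ε k * (z ^ k / k.factorial)‖ := fun z hz =>
    (hs z hz).norm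
  rw [tsum_mul_tsum_eq_tsum_sum_antidiagonal_of_summable_norm (hn x hx) (hn y hy)]
  refine (hs _ (add_nonneg hx hy)).tsum_le_tsum (fun n => ?_)
    (summable_norm_sum_mul_antidiagonal_of_summable_norm (hn x hx) (hn y hy)).of_norm
  rw [(Commute.all x y).add_pow', Finset.sum_div, Finset.mul_sum]
  refine Finset.sum_le_sum fun p hp => ?_
  obtain rfl := Finset.HasAntidiagonal.mem_antidiagonal.1 hp
  have hc : ((p.1 + p.2).choose p.1 : ℝ) * (p.1.factorial * p.2.factorial) =
      (p.1 + p.2).factorial := by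
    have := Nat.add_choose_mul_factorial_mul_factorial p.1 p.2
    rw [← this, Nat.choose_symm_add]; push_cast; ring
  have he : ε (p.1 + p.2) * ((p.1 + p.2).choose p.1 • (x ^ p.1 * y ^ p.2) / (p.1 + p.2).factorial) =
      ε (p.1 + p.2) * (x ^ p.1 / p.1.factorial * (y ^ p.2 / p.2.factorial)) := by
    have hcpos : ((p.1 + p.2).choose p.1 : ℝ) ≠ 0 := by
      exact_mod_cast (Nat.choose_pos (Nat.le_add_right _ _)).ne'
    rw [← hc, nsmul_eq_mul]
    field_simp
  rw [he]
  calc _ ≤ ε p.1 * ε p.2 * (x ^ p.1 / p.1.factorial * (y ^ p.2 / p.2.factorial)) := by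
        gcongr; exact hε _ _
    _ = _ := by ring

/-- A rapidly decaying sequence is absolutely summable against some submultiplicative weight which
grows faster than any polynomial. -/
theorem exists_weight {b : ℤ → ℂ} (hb : ∀ k : ℕ, Summable fun m : ℤ => |(m : ℝ)| ^ k * ‖b m‖) :
    ∃ w : ℤ → ℝ, (∀ m, 1 ≤ w m) ∧ (∀ m, w (-m) = w m) ∧ (∀ m n, w (m + n) ≤ w m * w n) ∧
      (∀ k : ℕ, ∃ C, ∀ m : ℤ, |(m : ℝ)| ^ k ≤ C * w m) ∧ Summable fun m => w m * ‖b m‖ := by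
  set M : ℕ → ℝ := fun k => ∑' m : ℤ, |(m : ℝ)| ^ k * ‖b m‖ with hM
  have hM0 : ∀ k, 0 ≤ M k := fun k => tsum_nonneg fun m => by positivity
  set r : ℕ → ℝ := fun k => (1 + ∑ j ∈ Finset.range (k + 1), M j)⁻¹ with hr
  have hden : ∀ k, 1 ≤ 1 + ∑ j ∈ Finset.range (k + 1), M j := fun k =>
    le_add_of_nonneg_right (Finset.sum_nonneg fun j _ => hM0 j)
  have hr0 : ∀ k, 0 < r k := fun k => inv_pos.2 (one_pos.trans_le (hden k))
  have hr1 : ∀ k, r k ≤ 1 := fun k => inv_le_one_of_one_le₀ (hden k)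
  have hra : Antitone r := fun j k hjk => by
    refine inv_anti₀ (one_pos.trans_le (hden j)) (add_le_add_right ?_ _)
    exact Finset.sum_le_sum_of_subset_of_nonneg (by simpa using hjk) fun i _ _ => hM0 i
  have hrM : ∀ k, r k * M k ≤ 1 := fun k => by
    rw [hr, inv_mul_le_one₀ (one_pos.trans_le (hden k))]
    have := Finset.single_le_sum (fun j _ => hM0 j) (Finset.self_mem_range_succ k)
    linarith
  set ε : ℕ → ℝ := fun k => r k ^ k with hε
  have hε0 : ∀ k, 0 < ε k := fun k => pow_pos (hr0 k) k
  have hε1 : ∀ k, ε k ≤ 1 := fun k => pow_le_one₀ (hr0 k).le (hr1 k)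
  have hεm : ∀ j k, ε (j + k) ≤ ε j * ε k := fun j k => by
    simp only [hε, pow_add]
    have h1 := hra (Nat.le_add_right j k)
    have h2 := hra (Nat.le_add_left k j)
    have := (hr0 (j + k)).le
    gcongr
  have hεM : ∀ k, ε k * M k ≤ 1 + M 0 := fun k => by
    rcases Nat.eq_zero_or_pos k with rfl | hk
    · simp [hε]
    · have : ε k ≤ r k := by simpa using pow_le_pow_of_le_one (hr0 k).le (hr1 k) hk
      linarith [mul_le_mul_of_nonneg_right this (hM0 k), hrM k, hM0 0]
  set W : ℝ → ℝ := fun x => ∑' k, ε k * (x ^ k / k.factorial) with hW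
  have hs : ∀ z : ℝ, 0 ≤ z → Summable fun k => ε k * (z ^ k / k.factorial) := fun z hz =>
    Summable.of_nonneg_of_le (fun k => mul_nonneg (hε0 k).le (by positivity))
      (fun k => mul_le_of_le_one_left (by positivity) (hε1 k)) (Real.summable_pow_div_factorial z)
  have hle : ∀ k z, 0 ≤ z → ε k * (z ^ k / k.factorial) ≤ W z := fun k z hz =>
    (hs z hz).le_tsum k fun j _ => mul_nonneg (hε0 j).le (by positivity)
  refine ⟨fun m => W |(m : ℝ)|, fun m => ?_, fun m => by simp, fun m n => ?_, fun k => ?_, ?_⟩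
  · simpa [hε] using hle 0 _ (abs_nonneg (m : ℝ))
  · refine le_trans ?_ (tsum_pow_div_factorial_add_le (fun k => (hε0 k).le) hε1 hεm
      (abs_nonneg (m : ℝ)) (abs_nonneg (n : ℝ)))
    refine (hs _ (abs_nonneg _)).tsum_le_tsum (fun k => ?_) (hs _ (by positivity))
    have := (hε0 k).le
    have := abs_add_le (m : ℝ) n
    push_cast
    gcongr
  · refine ⟨k.factorial / ε k, fun m => ?_⟩
    have := hle k _ (abs_nonneg (m : ℝ))
    have h1 := hε0 k
    rw [div_mul_eq_mul_div, le_div_iff₀ h1]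
    rw [← mul_div_assoc, div_le_iff₀ (by positivity)] at this
    linarith
  · have hf0 : ∀ p : ℕ × ℤ, 0 ≤ ε p.1 * (|(p.2 : ℝ)| ^ p.1 / p.1.factorial) * ‖b p.2‖ := fun p =>
      mul_nonneg (mul_nonneg (hε0 _).le (by positivity)) (norm_nonneg _)
    have hsum : Summable fun p : ℕ × ℤ =>
        ε p.1 * (|(p.2 : ℝ)| ^ p.1 / p.1.factorial) * ‖b p.2‖ := by
      have he : ∀ (k : ℕ) (m : ℤ), ε k * (|(m : ℝ)| ^ k / k.factorial) * ‖b m‖ =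
        ε k / k.factorial * (|(m : ℝ)| ^ k * ‖b m‖) := fun k m => by ring
      rw [summable_prod_of_nonneg hf0]
      refine ⟨fun k => ?_, ?_⟩
      · simp only [he]
        exact (hb k).mul_left _
      · simp only [he, tsum_mul_left]
        refine Summable.of_nonneg_of_le (fun k => ?_) (fun k => ?_)
          ((Real.summable_pow_div_factorial 1).mul_left (1 + M 0))
        · exact mul_nonneg (div_nonneg (hε0 k).le (by positivity)) (hM0 k)
        · rw [one_pow, mul_one_div, div_mul_eq_mul_div]
          gcongr
          exact hεM k
    have := (summable_prod_of_nonneg (f := fun p : ℤ × ℕ =>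
      ε p.2 * (|(p.1 : ℝ)| ^ p.2 / p.2.factorial) * ‖b p.1‖) (fun p => hf0 p.swap)).1
      ((Equiv.prodComm ℤ ℕ).summable_iff.2 hsum)
    simpa only [tsum_mul_right] using this.2

end Weight

section Synthesis

/-- Absolutely summable complex sequences indexed by `ℤ`. -/
abbrev SeqL1 := lp (fun _ : ℤ => ℂ) 1

theorem SeqL1.hasSum_norm (a : SeqL1) : HasSum (fun m => ‖a m‖) ‖a‖ := by
  simpa using lp.hasSum_norm (p := 1) (by simp) a

/-- The `m`-th unit vector. -/
def SeqL1.unit (m : ℤ) : SeqL1 := lp.single 1 m 1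

theorem SeqL1.norm_unit (m : ℤ) : ‖SeqL1.unit m‖ = 1 := by
  simp [SeqL1.unit, lp.norm_single]

theorem SeqL1.hasSum_unit (a : SeqL1) : HasSum (fun m => a m • SeqL1.unit m) a := by
  have := lp.hasSum_single (p := 1) (by simp) a
  simpa [SeqL1.unit, ← lp.single_smul] using this

variable {E : Type*} [NormedAddCommGroup E] [NormedSpace ℂ E]

theorem SeqL1.clm_ext {f g : SeqL1 →L[ℂ] E} (h : ∀ m, f (unit m) = g (unit m)) : f = g := by
  ext a
  refine (f.hasSum (SeqL1.hasSum_unit a)).unique ?_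
  simpa [h] using g.hasSum (SeqL1.hasSum_unit a)

variable [CompleteSpace E]

theorem SeqL1.summable_smul {v : ℤ → E} (hv : ∃ C, ∀ m, ‖v m‖ ≤ C) (a : SeqL1) :
    Summable fun m => a m • v m := by
  obtain ⟨C, hC⟩ := hv
  refine Summable.of_norm_bounded ((SeqL1.hasSum_norm a).summable.mul_right C) fun m => ?_
  rw [norm_smul]
  gcongr
  exact hC m

/-- The continuous linear map sending the `m`-th unit vector to `v m`. -/
def SeqL1.synth (v : ℤ → E) (hv : ∃ C, ∀ m, ‖v m‖ ≤ C) : SeqL1 →L[ℂ] E :=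
  LinearMap.mkContinuousOfExistsBound
    { toFun := fun a => ∑' m, a m • v m
      map_add' := fun a b => by
        simp only [lp.coeFn_add, Pi.add_apply, add_smul]
        exact (SeqL1.summable_smul hv a).tsum_add (SeqL1.summable_smul hv b)
      map_smul' := fun c a => by
        simp only [lp.coeFn_smul, Pi.smul_apply, smul_assoc, RingHom.id_apply]
        exact (SeqL1.summable_smul hv a).tsum_const_smul c }
    (by
      obtain ⟨C, hC⟩ := hv
      refine ⟨C, fun a => ?_⟩
      rw [mul_comm]
      refine tsum_of_norm_bounded ((SeqL1.hasSum_norm a).mul_right C) fun m => ?_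
      rw [norm_smul]
      gcongr
      exact hC m)

theorem SeqL1.synth_apply (v : ℤ → E) (hv) (a : SeqL1) : synth v hv a = ∑' m, a m • v m := rfl

theorem SeqL1.norm_synth_le {v : ℤ → E} (hv : ∃ C, ∀ m, ‖v m‖ ≤ C) {C : ℝ} (hC : ∀ m, ‖v m‖ ≤ C) :
    ‖synth v hv‖ ≤ C := by
  refine ContinuousLinearMap.opNorm_le_bound _ ((norm_nonneg _).trans (hC 0)) fun a => ?_
  rw [synth_apply, mul_comm]
  refine tsum_of_norm_bounded ((SeqL1.hasSum_norm a).mul_right C) fun m => ?_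
  rw [norm_smul]
  gcongr
  exact hC m

theorem SeqL1.norm_synth_apply_le {v : ℤ → E} (hv : ∃ C, ∀ m, ‖v m‖ ≤ C) {C : ℝ}
    (hC : ∀ m, ‖v m‖ ≤ C) (a : SeqL1) : ‖synth v hv a‖ ≤ C * ‖a‖ :=
  (synth v hv).le_of_opNorm_le (norm_synth_le hv hC) a

theorem SeqL1.synth_unit (v : ℤ → E) (hv) (m : ℤ) : synth v hv (unit m) = v m := by
  rw [synth_apply, tsum_eq_single m]
  · simp [unit]
  · intro n hn
    simp [unit, hn]

/-- Differentiation of `synth` with respect to a parameter. -/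
theorem SeqL1.hasDerivAt_synth {v v' v'' : ℝ → ℤ → E}
    (hv : ∀ s, ∃ C, ∀ m, ‖v s m‖ ≤ C) (hv' : ∀ s, ∃ C, ∀ m, ‖v' s m‖ ≤ C) {C : ℝ}
    (h1 : ∀ m s, HasDerivAt (fun s => v s m) (v' s m) s)
    (h2 : ∀ m s, HasDerivAt (fun s => v' s m) (v'' s m) s) (hC : ∀ m s, ‖v'' s m‖ ≤ C) (s : ℝ) :
    HasDerivAt (fun s => synth (v s) (hv s)) (synth (v' s) (hv' s)) s := by
  have hC0 : 0 ≤ C := (norm_nonneg _).trans (hC 0 0)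
  have hlip : ∀ m r, ‖v' r m - v' s m‖ ≤ C * ‖r - s‖ := fun m r =>
    convex_univ.norm_image_sub_le_of_norm_hasDerivWithin_le
      (fun r _ => (h2 m r).hasDerivWithinAt) (fun r _ => hC m r) trivial trivial
  have hquad : ∀ m r, ‖v r m - v s m - (r - s) • v' s m‖ ≤ C * ‖r - s‖ * ‖r - s‖ := fun m r => by
    have := (convex_closedBall s ‖r - s‖).norm_image_sub_le_of_norm_hasDerivWithin_le
      (f := fun y => v y m - y • v' s m) (f' := fun y => v' y m - (1 : ℝ) • v' s m)
      (C := C * ‖r - s‖) (x := s) (y := r)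
      (fun y _ => ((h1 m y).sub ((hasDerivAt_id y).smul_const _)).hasDerivWithinAt)
      (fun y hy => by
        rw [one_smul]
        refine (hlip m y).trans ?_
        gcongr
        rwa [mem_closedBall_iff_norm] at hy) (by simp) (by simp [Real.dist_eq])
    convert this using 2
    rw [sub_smul]; abel
  rw [hasDerivAt_iff_isLittleO, Asymptotics.isLittleO_iff]
  intro c hc
  have ev : ∀ᶠ r in nhds s, C * ‖r - s‖ < c := by
    have : Continuous fun r => C * ‖r - s‖ := by fun_prop
    exact this.continuousAt.eventually_lt continuousAt_const (by simpa using hc)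
  filter_upwards [ev] with r hr
  have hid : synth (v r) (hv r) - synth (v s) (hv s) - (r - s) • synth (v' s) (hv' s) =
      synth (fun m => v r m - v s m - (r - s) • v' s m) ⟨_, fun m => hquad m r⟩ :=
    clm_ext fun m => by simp [synth_unit]
  rw [hid]
  refine (norm_synth_le _ fun m => hquad m r).trans ?_
  gcongr

end Synthesis

section SineSynthesis

/-- Even submultiplicative weights growing faster than any polynomial. -/
structure IsRapidWeight (w : ℤ → ℝ) : Prop where
  one_le : ∀ m, 1 ≤ w m
  neg : ∀ m, w (-m) = w m
  add_le : ∀ m n, w (m + n) ≤ w m * w n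
  pow_le : ∀ k : ℕ, ∃ C, ∀ m : ℤ, |(m : ℝ)| ^ k ≤ C * w m

namespace IsRapidWeight

variable {w : ℤ → ℝ}

theorem pos (hw : IsRapidWeight w) (m : ℤ) : 0 < w m := one_pos.trans_le (hw.one_le m)

/-- The phase `exp (-i π² m² t)` of the free evolution of the `m`-th mode. -/
def phase (t : ℝ) (m : ℤ) : ℂ := Complex.exp (((-(Real.pi ^ 2 * m ^ 2 * t) : ℝ) : ℂ) * Complex.I)

theorem norm_phase (t : ℝ) (m : ℤ) : ‖phase t m‖ = 1 := Complex.norm_exp_ofReal_mul_I _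

theorem phase_zero (m : ℤ) : phase 0 m = 1 := by simp [phase]

theorem phase_mul_phase_neg (t : ℝ) (m : ℤ) : phase t m * phase (-t) m = 1 := by
  rw [phase, phase, ← Complex.exp_add]
  simp

theorem hasDerivAt_phase (t : ℝ) (m : ℤ) :
    HasDerivAt (fun t => phase t m) (-((Real.pi * m : ℝ) : ℂ) ^ 2 * Complex.I * phase t m) t := by
  have h1 : HasDerivAt (fun t : ℝ => -(Real.pi ^ 2 * m ^ 2 * t)) (-(Real.pi ^ 2 * m ^ 2)) t := by
    simpa using ((hasDerivAt_id t).const_mul (Real.pi ^ 2 * (m : ℝ) ^ 2)).fun_neg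
  have := (h1.ofReal_comp.mul_const Complex.I).cexp
  refine this.congr_deriv ?_
  rw [phase]
  push_cast
  ring

/-- The amplitude at `x` of the `j`-th derivative of the `m`-th weighted sine mode. -/
def amp (w : ℤ → ℝ) (j : ℕ) (x : ℝ) (m : ℤ) : ℝ :=
  (w m)⁻¹ * (Real.pi * m) ^ j * Real.sin (Real.pi * m * x + j * (Real.pi / 2))

theorem hasDerivAt_amp (w : ℤ → ℝ) (j : ℕ) (x : ℝ) (m : ℤ) :
    HasDerivAt (fun x => amp w j x m) (amp w (j + 1) x m) x := by
  have h1 : HasDerivAt (fun x : ℝ => Real.pi * m * x + j * (Real.pi / 2)) (Real.pi * m) x := by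
    simpa using ((hasDerivAt_id x).const_mul (Real.pi * (m : ℝ))).add_const (j * (Real.pi / 2))
  have := h1.sin.const_mul ((w m)⁻¹ * (Real.pi * m) ^ j)
  refine this.congr_deriv ?_
  rw [amp, ← Real.sin_add_pi_div_two]
  push_cast
  ring_nf

theorem amp_add_two (w : ℤ → ℝ) (j : ℕ) (x : ℝ) (m : ℤ) :
    amp w (j + 2) x m = -(Real.pi * m) ^ 2 * amp w j x m := by
  unfold amp
  have : Real.pi * m * x + ((j + 2 : ℕ) : ℝ) * (Real.pi / 2) =
      Real.pi * m * x + j * (Real.pi / 2) + Real.pi := by push_cast; ring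
  rw [this, Real.sin_add_pi]
  ring

theorem exists_amp_le (hw : IsRapidWeight w) (j : ℕ) : ∃ C, ∀ x m, |amp w j x m| ≤ C := by
  obtain ⟨C, hC⟩ := hw.pow_le j
  refine ⟨Real.pi ^ j * C, fun x m => ?_⟩
  have hwm := hw.pos m
  rw [amp, abs_mul, abs_mul, abs_pow, abs_mul, abs_of_pos Real.pi_pos, mul_pow, abs_inv,
    abs_of_pos hwm]
  have h1 := Real.abs_sin_le_one (Real.pi * m * x + j * (Real.pi / 2))
  have h2 : (w m)⁻¹ * (Real.pi ^ j * |(m : ℝ)| ^ j) ≤ Real.pi ^ j * C := by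
    rw [inv_mul_le_iff₀ hwm]
    have := mul_le_mul_of_nonneg_left (hC m) (pow_pos Real.pi_pos j).le
    linarith
  exact (mul_le_of_le_one_right (by positivity) h1).trans h2

theorem exists_mode_le (hw : IsRapidWeight w) (j : ℕ) :
    ∃ C, ∀ x t m, ‖(amp w j x m : ℂ) * phase t m‖ ≤ C := by
  obtain ⟨C, hC⟩ := hw.exists_amp_le j
  exact ⟨C, fun x t m => by simpa [norm_phase] using hC x m⟩

variable (hw : IsRapidWeight w)

/-- The functional evaluating at `(x, t)` the `j`-th space derivative of
`∑ a m (w m)⁻¹ exp (-i π² m² t) sin (π m x)`. -/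
def ev (j : ℕ) (x t : ℝ) : SeqL1 →L[ℂ] ℂ :=
  SeqL1.synth (fun m => (amp w j x m : ℂ) * phase t m)
    ((hw.exists_mode_le j).imp fun _ hC m => hC x t m)

theorem ev_unit (j : ℕ) (x t : ℝ) (m : ℤ) :
    hw.ev j x t (SeqL1.unit m) = (amp w j x m : ℂ) * phase t m := SeqL1.synth_unit _ _ _

theorem exists_norm_ev_le (j : ℕ) : ∃ C : NNReal, ∀ x t, ‖hw.ev j x t‖ ≤ C := by
  obtain ⟨C, hC⟩ := hw.exists_mode_le j
  exact ⟨C.toNNReal, fun x t => (SeqL1.norm_synth_le _ (hC x t)).trans (Real.le_coe_toNNReal C)⟩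

theorem hasDerivAt_ev_fst (j : ℕ) (x t : ℝ) :
    HasDerivAt (fun x => hw.ev j x t) (hw.ev (j + 1) x t) x := by
  obtain ⟨C, hC⟩ := hw.exists_mode_le (j + 2)
  exact SeqL1.hasDerivAt_synth (fun x => (hw.exists_mode_le j).imp fun _ hC m => hC x t m)
    (fun x => (hw.exists_mode_le (j + 1)).imp fun _ hC m => hC x t m)
    (fun m s => (hasDerivAt_amp w j s m).ofReal_comp.mul_const (phase t m))
    (fun m s => (hasDerivAt_amp w (j + 1) s m).ofReal_comp.mul_const (phase t m))
    (fun m s => hC s t m) x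

theorem hasDerivAt_mode_snd (j : ℕ) (x t : ℝ) (m : ℤ) :
    HasDerivAt (fun t => (amp w j x m : ℂ) * phase t m)
      (Complex.I * ((amp w (j + 2) x m : ℂ) * phase t m)) t := by
  refine ((hasDerivAt_phase t m).const_mul (amp w j x m : ℂ)).congr_deriv ?_
  rw [amp_add_two]
  push_cast
  ring

theorem hasDerivAt_ev_snd (j : ℕ) (x t : ℝ) :
    HasDerivAt (fun t => hw.ev j x t) (Complex.I • hw.ev (j + 2) x t) t := by
  obtain ⟨C, hC⟩ := hw.exists_mode_le (j + 2 + 2)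
  have hb : ∀ t, ∃ C, ∀ m, ‖Complex.I * ((amp w (j + 2) x m : ℂ) * phase t m)‖ ≤ C := fun t => by
    obtain ⟨C, hC⟩ := hw.exists_mode_le (j + 2)
    exact ⟨C, fun m => by simpa using hC x t m⟩
  have := SeqL1.hasDerivAt_synth (fun t => (hw.exists_mode_le j).imp fun _ hC m => hC x t m) hb
    (v'' := fun t m => Complex.I * (Complex.I * ((amp w (j + 2 + 2) x m : ℂ) * phase t m)))
    (C := C) (fun m s => hasDerivAt_mode_snd j x s m)
    (fun m s => (hasDerivAt_mode_snd (j + 2) x s m).const_mul Complex.I)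
    (fun m s => by simpa using hC x s m) t
  exact this.congr_deriv (SeqL1.clm_ext fun m => by simp [SeqL1.synth_unit, ev_unit])

theorem continuous_ev (j : ℕ) : Continuous fun p : ℝ × ℝ => hw.ev j p.1 p.2 := by
  obtain ⟨C, hC⟩ := hw.exists_norm_ev_le (j + 1)
  refine continuous_prod_of_continuous_lipschitzWith _ C (fun x => ?_) (fun t => ?_)
  · exact continuous_iff_continuousAt.2 fun t => (hw.hasDerivAt_ev_snd j x t).continuousAt
  · exact lipschitzWith_of_nnnorm_deriv_le
      (fun x => (hw.hasDerivAt_ev_fst j x t).differentiableAt) fun x => by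
        rw [(hw.hasDerivAt_ev_fst j x t).deriv]
        exact hC x t

/-- The free propagator on sequences. -/
def prop (t : ℝ) : SeqL1 →L[ℂ] SeqL1 :=
  SeqL1.synth (fun m => phase t m • SeqL1.unit m)
    ⟨1, fun m => by simp [norm_smul, norm_phase, SeqL1.norm_unit]⟩

theorem prop_unit (t : ℝ) (m : ℤ) : prop t (SeqL1.unit m) = phase t m • SeqL1.unit m :=
  SeqL1.synth_unit _ _ _

theorem norm_prop_le (t : ℝ) : ‖prop t‖ ≤ 1 :=
  SeqL1.norm_synth_le _ fun m => by simp [norm_smul, norm_phase, SeqL1.norm_unit]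

theorem norm_prop_apply_le (t : ℝ) (a : SeqL1) : ‖prop t a‖ ≤ ‖a‖ := by
  simpa using (prop t).le_of_opNorm_le (norm_prop_le t) a

theorem ev_prop (j : ℕ) (x t : ℝ) (a : SeqL1) : hw.ev j x 0 (prop t a) = hw.ev j x t a := by
  have : (hw.ev j x 0).comp (prop t) = hw.ev j x t := SeqL1.clm_ext fun m => by
    simp [prop_unit, ev_unit, phase_zero, mul_comm]
  exact DFunLike.congr_fun this a

theorem prop_prop_neg (t : ℝ) (a : SeqL1) : prop t (prop (-t) a) = a := by
  have : (prop t).comp (prop (-t)) = ContinuousLinearMap.id ℂ SeqL1 := SeqL1.clm_ext fun m => by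
    simp [prop_unit, smul_smul, mul_comm (phase (-t) m), phase_mul_phase_neg]
  exact DFunLike.congr_fun this a

theorem continuous_prop : Continuous fun p : ℝ × SeqL1 => prop p.1 p.2 := by
  refine continuous_prod_of_continuous_lipschitzWith' _ 1 (fun t => ?_) (fun a => ?_)
  · exact ((prop t).lipschitz).weaken (norm_prop_le t)
  · simp only [prop, SeqL1.synth_apply]
    refine continuous_tsum (fun m => ?_) (SeqL1.hasSum_norm a).summable fun m t => ?_
    · have : Continuous fun t => phase t m := continuous_iff_continuousAt.2 fun t =>
        (hasDerivAt_phase t m).continuousAt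
      fun_prop
    · simp [norm_smul, norm_phase, SeqL1.norm_unit]

/-- The coefficients of the product of three weighted sine modes. -/
def triCoef (w : ℤ → ℝ) (m n k : ℤ) : SeqL1 :=
  let c : ℤ → SeqL1 := fun l => ((w l / (w m * w n * w k) : ℝ) : ℂ) • SeqL1.unit l
  (4⁻¹ : ℂ) • (c (m - n + k) + c (-m + n + k) + c (m + n - k) - c (m + n + k))

theorem norm_triCoef_le (hw : IsRapidWeight w) (m n k : ℤ) : ‖triCoef w m n k‖ ≤ 1 := by
  have h : ∀ m' n' k', w m' = w m → w n' = w n → w k' = w k →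
      ‖((w (m' + n' + k') / (w m * w n * w k) : ℝ) : ℂ) • SeqL1.unit (m' + n' + k')‖ ≤ 1 := by
    intro m' n' k' hm hn hk
    have hm0 := hw.pos m
    have hn0 := hw.pos n
    have hk0 := hw.pos k
    rw [norm_smul, SeqL1.norm_unit, mul_one, Complex.norm_real, Real.norm_eq_abs,
      abs_of_nonneg (div_nonneg (hw.pos _).le (by positivity)), div_le_one (by positivity)]
    calc _ ≤ w (m' + n') * w k' := hw.add_le _ _
      _ ≤ w m' * w n' * w k' := by
        gcongr
        · exact (hw.pos _).le
        · exact hw.add_le _ _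
      _ = _ := by rw [hm, hn, hk]
  have h1 := h m (-n) k rfl (hw.neg n) rfl
  have h2 := h (-m) n k (hw.neg m) rfl rfl
  have h3 := h m n (-k) rfl rfl (hw.neg k)
  have h4 := h m n k rfl rfl rfl
  rw [← sub_eq_add_neg] at h1
  rw [← sub_eq_add_neg] at h3
  rw [triCoef, norm_smul]
  have h5 := norm_sub_le_of_le (norm_add_le_of_le (norm_add_le_of_le h1 h2) h3) h4
  have : ‖(4⁻¹ : ℂ)‖ = 4⁻¹ := by simp
  rw [this]
  linarith

/-- The trilinear map on sequences representing the product of three functions. -/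
def tri : SeqL1 →L[ℂ] SeqL1 →L[ℂ] SeqL1 →L[ℂ] SeqL1 :=
  SeqL1.synth (fun m => SeqL1.synth (fun n => SeqL1.synth (fun k => triCoef w m n k)
    ⟨1, fun k => hw.norm_triCoef_le m n k⟩)
    ⟨1, fun n => SeqL1.norm_synth_le _ fun k => hw.norm_triCoef_le m n k⟩)
    ⟨1, fun m => SeqL1.norm_synth_le _ fun n => SeqL1.norm_synth_le _
      fun k => hw.norm_triCoef_le m n k⟩

theorem norm_tri_apply_le (a b c : SeqL1) : ‖hw.tri a b c‖ ≤ ‖a‖ * ‖b‖ * ‖c‖ := by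
  have h1 : ‖hw.tri a‖ ≤ 1 * ‖a‖ := SeqL1.norm_synth_apply_le _ (fun m => SeqL1.norm_synth_le _
    fun n => SeqL1.norm_synth_le _ fun k => hw.norm_triCoef_le m n k) a
  rw [one_mul] at h1
  exact (hw.tri a b).le_of_opNorm_le ((hw.tri a).le_of_opNorm_le h1 b) c

theorem ev_triCoef (x : ℝ) (m n k : ℤ) : hw.ev 0 x 0 (triCoef w m n k) =
    (amp w 0 x m : ℂ) * amp w 0 x n * amp w 0 x k := by
  have hc : ∀ l : ℤ, (((w l / (w m * w n * w k) : ℝ) : ℂ)) * (amp w 0 x l : ℂ) =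
      ((Real.sin (Real.pi * l * x) / (w m * w n * w k) : ℝ) : ℂ) := fun l => by
    rw [← Complex.ofReal_mul, Complex.ofReal_inj]
    have := (hw.pos l).ne'
    simp only [amp, pow_zero, mul_one, Nat.cast_zero, zero_mul, add_zero]
    field_simp
  simp only [triCoef, map_smul, map_add, map_sub, ev_unit, phase_zero, smul_eq_mul, mul_one, hc]
  rw [show (4⁻¹ : ℂ) = ((4⁻¹ : ℝ) : ℂ) by simp]
  simp only [← Complex.ofReal_mul, ← Complex.ofReal_add, ← Complex.ofReal_sub, Complex.ofReal_inj]
  have hm := (hw.pos m).ne'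
  have hn := (hw.pos n).ne'
  have hk := (hw.pos k).ne'
  simp only [amp]
  push_cast
  simp only [pow_zero, mul_one, zero_mul, add_zero]
  have trig : ∀ A B C : ℝ, Real.sin (A - B + C) + Real.sin (-A + B + C) + Real.sin (A + B - C) -
      Real.sin (A + B + C) = 4 * (Real.sin A * Real.sin B * Real.sin C) := fun A B C => by
    simp only [Real.sin_add, Real.sin_sub, Real.cos_add, Real.cos_sub, Real.sin_neg, Real.cos_neg]
    ring
  have := trig (Real.pi * m * x) (Real.pi * n * x) (Real.pi * k * x)
  field_simp
  convert this using 1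
  · ring_nf
  · ring

theorem ev_tri (x : ℝ) (a b c : SeqL1) :
    hw.ev 0 x 0 (hw.tri a b c) = hw.ev 0 x 0 a * hw.ev 0 x 0 b * hw.ev 0 x 0 c := by
  have h3 : ∀ m n c, hw.ev 0 x 0 (hw.tri (SeqL1.unit m) (SeqL1.unit n) c) =
      (amp w 0 x m : ℂ) * amp w 0 x n * hw.ev 0 x 0 c := fun m n c => by
    have : (hw.ev 0 x 0).comp (hw.tri (SeqL1.unit m) (SeqL1.unit n)) =
        ((amp w 0 x m : ℂ) * amp w 0 x n) • hw.ev 0 x 0 := SeqL1.clm_ext fun k => by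
      simp [tri, SeqL1.synth_unit, ev_triCoef, ev_unit, phase_zero]
    exact DFunLike.congr_fun this c
  have h2 : ∀ m b c, hw.ev 0 x 0 (hw.tri (SeqL1.unit m) b c) =
      (amp w 0 x m : ℂ) * hw.ev 0 x 0 b * hw.ev 0 x 0 c := fun m b c => by
    have : (hw.ev 0 x 0).comp ((hw.tri (SeqL1.unit m)).flip c) =
        ((amp w 0 x m : ℂ) * hw.ev 0 x 0 c) • hw.ev 0 x 0 := SeqL1.clm_ext fun n => by
      simp [h3, ev_unit, phase_zero]
      ring
    have := DFunLike.congr_fun this b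
    simp only [ContinuousLinearMap.comp_apply, ContinuousLinearMap.flip_apply] at this
    rw [this]
    simp
    ring
  have : (hw.ev 0 x 0).comp ((hw.tri.flip b).flip c) =
      (hw.ev 0 x 0 b * hw.ev 0 x 0 c) • hw.ev 0 x 0 := SeqL1.clm_ext fun n => by
    simp [h2, ev_unit, phase_zero]
    ring
  have := DFunLike.congr_fun this a
  simp only [ContinuousLinearMap.comp_apply, ContinuousLinearMap.flip_apply] at this
  rw [this]
  simp
  ring

theorem ev_star (j : ℕ) (x : ℝ) (a : SeqL1) :
    hw.ev j x 0 (star a) = star (hw.ev j x 0 a) := by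
  simp only [ev, SeqL1.synth_apply, tsum_star]
  simp [phase_zero]

end IsRapidWeight

end SineSynthesis

section NLS

/-- Local solvability of an ODE whose right-hand side satisfies cubic bounds. -/
theorem exists_ode_of_cubic {X : Type*} [NormedAddCommGroup X] [NormedSpace ℝ X] [CompleteSpace X]
    {F : ℝ → X → X} (hF0 : ∀ t, F t 0 = 0) (hFc : ∀ a, Continuous fun t => F t a)
    (hF : ∀ t R a b, ‖a‖ ≤ R → ‖b‖ ≤ R → ‖F t a - F t b‖ ≤ 3 * R ^ 2 * ‖a - b‖) (y₀ : X) :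
    ∃ T > 0, ∃ y : ℝ → X, y 0 = y₀ ∧ ∀ t ∈ Ioo (-T) T, HasDerivAt y (F t (y t)) t := by
  set R : ℝ := ‖y₀‖ + 1 with hR
  have hR0 : 0 < R := by positivity
  set T : ℝ := (3 * R ^ 3)⁻¹ with hT
  have hT0 : 0 < T := by positivity
  have hball : ∀ a ∈ Metric.closedBall y₀ ((1 : NNReal) : ℝ), ‖a‖ ≤ R := fun a ha => by
    rw [mem_closedBall_iff_norm] at ha
    have := norm_add_le (a - y₀) y₀
    rw [sub_add_cancel] at this
    push_cast at ha
    linarith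
  have h0 : (0 : ℝ) ∈ Icc (-T) T := ⟨by linarith, hT0.le⟩
  have hPL : IsPicardLindelof F (⟨0, h0⟩ : Icc (-T) T) y₀ 1 0 (3 * R ^ 3).toNNReal
      (3 * R ^ 2).toNNReal := by
    refine ⟨fun t _ => ?_, fun x _ => (hFc x).continuousOn, fun t _ x hx => ?_, ?_⟩
    · refine LipschitzOnWith.of_dist_le_mul fun a ha b hb => ?_
      rw [dist_eq_norm, dist_eq_norm, Real.coe_toNNReal _ (by positivity)]
      exact hF t R a b (hball a ha) (hball b hb)
    · rw [Real.coe_toNNReal _ (by positivity)]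
      have h1 := hF t R x 0 (hball x hx) (by simpa using hR0.le)
      rw [hF0, sub_zero, sub_zero] at h1
      have := hball x hx
      calc _ ≤ _ := h1
        _ ≤ 3 * R ^ 2 * R := by gcongr
        _ = _ := by ring
    · rw [Real.coe_toNNReal _ (by positivity)]
      simp [hT]
      field_simp
      rfl
  obtain ⟨y, hy0, hy⟩ := hPL.exists_eq_forall_mem_Icc_hasDerivWithinAt₀
  exact ⟨T, hT0, y, hy0, fun t ht =>
    (hy t (Ioo_subset_Icc_self ht)).hasDerivAt (Icc_mem_nhds ht.1 ht.2)⟩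

namespace IsRapidWeight

variable {w : ℤ → ℝ} (hw : IsRapidWeight w)

/-- The cubic nonlinearity `(i / 2) |q|² q` on sequences. -/
def cubic (a : SeqL1) : SeqL1 := (Complex.I / 2) • hw.tri a (star a) a

theorem norm_cubic_sub_le {R : ℝ} {a b : SeqL1} (ha : ‖a‖ ≤ R) (hb : ‖b‖ ≤ R) :
    ‖hw.cubic a - hw.cubic b‖ ≤ 3 * R ^ 2 * ‖a - b‖ := by
  have hid : hw.tri a (star a) a - hw.tri b (star b) b = hw.tri (a - b) (star a) a +
      hw.tri b (star (a - b)) a + hw.tri b (star b) (a - b) := by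
    simp only [map_sub, star_sub, sub_apply]
    abel
  have hR : 0 ≤ R := (norm_nonneg _).trans ha
  have h1 := hw.norm_tri_apply_le (a - b) (star a) a
  have h2 := hw.norm_tri_apply_le b (star (a - b)) a
  have h3 := hw.norm_tri_apply_le b (star b) (a - b)
  rw [norm_star] at h1 h2 h3
  have k1 : ‖a - b‖ * ‖a‖ * ‖a‖ ≤ ‖a - b‖ * R * R := by gcongr
  have k2 : ‖b‖ * ‖a - b‖ * ‖a‖ ≤ R * ‖a - b‖ * R := by gcongr
  have k3 : ‖b‖ * ‖b‖ * ‖a - b‖ ≤ R * R * ‖a - b‖ := by gcongr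
  rw [cubic, cubic, ← smul_sub, hid, norm_smul]
  have h4 := norm_add_le_of_le (norm_add_le_of_le h1 h2) h3
  have h5 : ‖Complex.I / 2‖ ≤ 1 := by norm_num
  refine (mul_le_of_le_one_left (norm_nonneg _) h5).trans (h4.trans ?_)
  nlinarith

theorem continuous_cubic : Continuous hw.cubic := by
  refine continuous_iff_continuousAt.2 fun a => ?_
  have hlip : LipschitzOnWith (3 * (‖a‖ + 1) ^ 2).toNNReal hw.cubic (Metric.ball 0 (‖a‖ + 1)) := by
    refine LipschitzOnWith.of_dist_le_mul fun b hb c hc => ?_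
    rw [dist_eq_norm, dist_eq_norm, Real.coe_toNNReal _ (by positivity)]
    exact hw.norm_cubic_sub_le (by simpa using (mem_ball_zero_iff.1 hb).le)
      (by simpa using (mem_ball_zero_iff.1 hc).le)
  exact hlip.continuousOn.continuousAt (Metric.isOpen_ball.mem_nhds (by simp))

theorem ev_cubic (x : ℝ) (a : SeqL1) : hw.ev 0 x 0 (hw.cubic a) =
    Complex.I / 2 * (hw.ev 0 x 0 a * star (hw.ev 0 x 0 a) * hw.ev 0 x 0 a) := by
  rw [cubic, map_smul, ev_tri, ev_star, smul_eq_mul]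

theorem continuous_prop_apply {f : ℝ → ℝ} {g : ℝ → SeqL1} (hf : Continuous f) (hg : Continuous g) :
    Continuous fun s => prop (f s) (g s) := by
  have h2 : Continuous fun s => (f s, g s) := hf.prodMk hg
  have h3 := continuous_prop.comp h2
  exact h3

theorem exists_interaction_solution (y₀ : SeqL1) : ∃ T > 0, ∃ y : ℝ → SeqL1, y 0 = y₀ ∧
    ∀ t ∈ Ioo (-T) T, HasDerivAt y (prop (-t) (hw.cubic (prop t (y t)))) t := by
  refine exists_ode_of_cubic (F := fun t a => prop (-t) (hw.cubic (prop t a)))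
    (fun t => by simp [cubic]) (fun a => ?_) (fun t R a b ha hb => ?_) y₀
  · have h1 : Continuous fun t : ℝ => hw.cubic (prop t a) :=
      hw.continuous_cubic.comp (continuous_prop_apply continuous_id continuous_const)
    exact continuous_prop_apply continuous_neg h1
  · rw [← map_sub]
    refine (norm_prop_apply_le _ _).trans ((hw.norm_cubic_sub_le
      ((norm_prop_apply_le _ _).trans ha) ((norm_prop_apply_le _ _).trans hb)).trans ?_)
    rw [← map_sub]
    gcongr
    exact norm_prop_apply_le _ _

theorem hasDerivAt_ev_apply (j : ℕ) (x t : ℝ) (a : SeqL1) :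
    HasDerivAt (fun x => hw.ev j x t a) (hw.ev (j + 1) x t a) x := by
  have := ((ContinuousLinearMap.apply ℂ ℂ a).restrictScalars ℝ).hasFDerivAt.comp_hasDerivAt x
    (hw.hasDerivAt_ev_fst j x t)
  simpa [Function.comp_def] using this

theorem hasDerivAt_ev_curve (j : ℕ) (x t : ℝ) {y : ℝ → SeqL1} {y' : SeqL1}
    (hy : HasDerivAt y y' t) :
    HasDerivAt (fun t => hw.ev j x t (y t))
      (Complex.I * hw.ev (j + 2) x t (y t) + hw.ev j x t y') t := by
  have h1 := (ContinuousLinearMap.restrictScalarsL ℂ SeqL1 ℂ ℝ ℝ).hasFDerivAt.comp_hasDerivAt t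
    (hw.hasDerivAt_ev_snd j x t)
  exact (HasDerivAt.clm_apply h1 hy).congr_deriv (by simp)

theorem contDiffOn_ev_curve {U : Set (ℝ × ℝ)} (hU : IsOpen U) {y : ℝ → SeqL1}
    (hy : ∀ p ∈ U, HasDerivAt y (prop (-p.2) (hw.cubic (prop p.2 (y p.2)))) p.2) (j : ℕ) :
    ContDiffOn ℝ (⊤ : ℕ∞) (fun p => hw.ev j p.1 p.2 (y p.2)) U := by
  set g : ℕ → ℝ × ℝ → ℂ := fun j p => hw.ev j p.1 p.2 (y p.2) with hg
  have hgx : ∀ j p, HasDerivAt (fun x => g j (x, p.2)) (g (j + 1) p) p.1 := fun j p =>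
    hw.hasDerivAt_ev_apply j p.1 p.2 (y p.2)
  set h : ℕ × ℕ × ℕ → ℝ × ℝ → ℂ := fun k p => g k.1 p * star (g k.2.1 p) * g k.2.2 p with hh
  have hspan : ∀ f ∈ Submodule.span ℂ (range h), ∃ f' ∈ Submodule.span ℂ (range h),
      ∀ p : ℝ × ℝ, HasDerivAt (fun x => f (x, p.2)) (f' p) p.1 := by
    intro f hf
    induction hf using Submodule.span_induction with
    | mem f hf =>
      obtain ⟨⟨k, l, m⟩, rfl⟩ := hf
      refine ⟨h (k + 1, l, m) + h (k, l + 1, m) + h (k, l, m + 1),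
        add_mem (add_mem (Submodule.subset_span ⟨_, rfl⟩) (Submodule.subset_span ⟨_, rfl⟩))
          (Submodule.subset_span ⟨_, rfl⟩), fun p => ?_⟩
      refine (((hgx k p).mul (hgx l p).star).mul (hgx m p)).congr_deriv ?_
      simp only [hh, Pi.add_apply, Pi.mul_apply]
      ring
    | zero => exact ⟨0, zero_mem _, fun p => by simpa using hasDerivAt_const p.1 (0 : ℂ)⟩
    | add f₁ f₂ _ _ h₁ h₂ =>
      obtain ⟨f₁', m₁, d₁⟩ := h₁
      obtain ⟨f₂', m₂, d₂⟩ := h₂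
      exact ⟨f₁' + f₂', add_mem m₁ m₂, fun p => (d₁ p).add (d₂ p)⟩
    | smul c f _ h₁ =>
      obtain ⟨f', m₁, d₁⟩ := h₁
      exact ⟨c • f', Submodule.smul_mem _ _ m₁, fun p => (d₁ p).const_smul c⟩
  have hN : ∀ j, (fun p : ℝ × ℝ => hw.ev j p.1 0 (hw.cubic (prop p.2 (y p.2)))) ∈
      Submodule.span ℂ (range h) := by
    intro j
    induction j with
    | zero =>
      have : (fun p : ℝ × ℝ => hw.ev 0 p.1 0 (hw.cubic (prop p.2 (y p.2)))) =
          (Complex.I / 2) • h (0, 0, 0) := by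
        ext p
        simp only [ev_cubic, ev_prop, hh, hg, Pi.smul_apply, smul_eq_mul]
      rw [this]
      exact Submodule.smul_mem _ _ (Submodule.subset_span ⟨_, rfl⟩)
    | succ j ih =>
      obtain ⟨f', hf', hd⟩ := hspan _ ih
      convert hf' using 1
      funext p
      exact (hw.hasDerivAt_ev_apply j p.1 0 _).unique (hd p)
  have hgt : ∀ j, ∀ p ∈ U, HasDerivAt (fun t => g j (p.1, t))
      (Complex.I * g (j + 2) p + hw.ev j p.1 0 (hw.cubic (prop p.2 (y p.2)))) p.2 :=
    fun j p hp => (hw.hasDerivAt_ev_curve j p.1 p.2 (hy p hp)).congr_deriv (by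
      rw [← ev_prop hw j p.1 p.2 (prop (-p.2) _), prop_prop_neg])
  rw [contDiffOn_infty]
  intro n
  induction n generalizing j with
  | zero =>
    simp only [CharP.cast_eq_zero, contDiffOn_zero]
    have hyc : ContinuousOn (fun p : ℝ × ℝ => y p.2) U := fun p hp =>
      ((hy p hp).continuousAt.comp continuousAt_snd).continuousWithinAt
    exact (hw.continuous_ev j).continuousOn.clm_apply hyc
  | succ n ih =>
    refine contDiffOn_succ_of_partials hU (ih (j + 1)) ?_ (fun p _ => hgx j p) (hgt j)
    have hsm : ∀ f ∈ Submodule.span ℂ (range h), ContDiffOn ℝ n f U := by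
      intro f hf
      induction hf using Submodule.span_induction with
      | mem f hf =>
        obtain ⟨⟨k, l, m⟩, rfl⟩ := hf
        exact ((ih k).mul ((starL' ℝ : ℂ ≃L[ℝ] ℂ).contDiff.comp_contDiffOn (ih l))).mul (ih m)
      | zero => exact contDiffOn_const
      | add f₁ f₂ _ _ h₁ h₂ => exact h₁.add h₂
      | smul c f _ h₁ => exact h₁.const_smul c
    exact (contDiffOn_const.mul (ih (j + 2))).add (hsm _ (hN j))

end IsRapidWeight

/-- Local existence of smooth solutions of the cubic nonlinear Schrödinger equation with Dirichlet
boundary conditions on `[0, 1]`, for rapidly convergent sine series as initial data. -/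
theorem exists_nls_solution {b : ℤ → ℂ}
    (hb : ∀ k : ℕ, Summable fun m : ℤ => |(m : ℝ)| ^ k * ‖b m‖) :
    ∃ T > 0, ∃ q q₁ q₂ : ℝ × ℝ → ℂ,
      ContDiffOn ℝ (⊤ : ℕ∞) q (univ ×ˢ Ioo (-T) T) ∧
      ContDiffOn ℝ (⊤ : ℕ∞) q₁ (univ ×ˢ Ioo (-T) T) ∧
      ContDiffOn ℝ (⊤ : ℕ∞) q₂ (univ ×ˢ Ioo (-T) T) ∧
      (∀ p : ℝ × ℝ, HasDerivAt (fun x => q (x, p.2)) (q₁ p) p.1) ∧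
      (∀ p : ℝ × ℝ, HasDerivAt (fun x => q₁ (x, p.2)) (q₂ p) p.1) ∧
      (∀ p ∈ (univ ×ˢ Ioo (-T) T : Set (ℝ × ℝ)), HasDerivAt (fun t => q (p.1, t))
        (Complex.I * q₂ p + Complex.I / 2 * (q p * star (q p) * q p)) p.2) ∧
      (∀ t, q (0, t) = 0 ∧ q (1, t) = 0) ∧
      ∀ x, q (x, 0) = ∑' m, b m * (Real.sin (Real.pi * m * x) : ℂ) := by
  obtain ⟨w, h1, h2, h3, h4, h5⟩ := exists_weight hb
  have hw : IsRapidWeight w := ⟨h1, h2, h3, h4⟩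
  have hmem : Memℓp (fun m : ℤ => (w m : ℂ) * b m) 1 := by
    refine memℓp_gen ?_
    simpa [abs_of_pos (hw.pos _)] using h5
  obtain ⟨T, hT, y, hy0, hy⟩ := hw.exists_interaction_solution ⟨_, hmem⟩
  have hU : IsOpen (univ ×ˢ Ioo (-T) T : Set (ℝ × ℝ)) := isOpen_univ.prod isOpen_Ioo
  have hyU : ∀ p ∈ (univ ×ˢ Ioo (-T) T : Set (ℝ × ℝ)), HasDerivAt y
    (IsRapidWeight.prop (-p.2) (hw.cubic (IsRapidWeight.prop p.2 (y p.2)))) p.2 :=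
    fun p hp => hy p.2 hp.2
  refine ⟨T, hT, fun p => hw.ev 0 p.1 p.2 (y p.2), fun p => hw.ev 1 p.1 p.2 (y p.2),
    fun p => hw.ev 2 p.1 p.2 (y p.2), hw.contDiffOn_ev_curve hU hyU 0,
    hw.contDiffOn_ev_curve hU hyU 1, hw.contDiffOn_ev_curve hU hyU 2,
    fun p => hw.hasDerivAt_ev_apply 0 p.1 p.2 (y p.2),
    fun p => hw.hasDerivAt_ev_apply 1 p.1 p.2 (y p.2), fun p hp => ?_,
    fun t => ⟨?_, ?_⟩, fun x => ?_⟩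
  · refine (hw.hasDerivAt_ev_curve 0 p.1 p.2 (hyU p hp)).congr_deriv ?_
    rw [← hw.ev_prop 0 p.1 p.2 (IsRapidWeight.prop (-p.2) _), IsRapidWeight.prop_prop_neg,
      hw.ev_cubic, hw.ev_prop]
  · have : hw.ev 0 0 t = 0 := SeqL1.clm_ext fun m => by
      simp [IsRapidWeight.ev_unit, IsRapidWeight.amp]
    simp [this]
  · have : hw.ev 0 1 t = 0 := SeqL1.clm_ext fun m => by
      simp [IsRapidWeight.ev_unit, IsRapidWeight.amp, mul_comm Real.pi]
    simp [this]
  · simp only [hy0, IsRapidWeight.ev, SeqL1.synth_apply]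
    refine tsum_congr fun m => ?_
    have := (hw.pos m).ne'
    have h : (w m : ℂ) ≠ 0 := by exact_mod_cast this
    simp [IsRapidWeight.phase_zero, IsRapidWeight.amp]
    field_simp

end NLS

section SineSeries

def sineCoeff (f : ℝ → ℂ) (n : ℤ) : ℂ := ∫ x in (0:ℝ)..1, f x * (Real.sin (Real.pi * n * x) : ℂ)

theorem sineCoeff_of_hasDerivAt {f f' f'' : ℝ → ℂ} (hf : ∀ x, HasDerivAt f (f' x) x)
    (hf' : ∀ x, HasDerivAt f' (f'' x) x) (hc : Continuous f'') (h0 : f 0 = 0) (h1 : f 1 = 0)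
    (n : ℤ) : ((Real.pi * n : ℝ) : ℂ) ^ 2 * sineCoeff f n = - sineCoeff f'' n := by
  have hcf : Continuous f := continuous_iff_continuousAt.2 fun x => (hf x).continuousAt
  have hcf' : Continuous f' := continuous_iff_continuousAt.2 fun x => (hf' x).continuousAt
  have hlin : ∀ x : ℝ, HasDerivAt (fun x : ℝ => Real.pi * n * x) (Real.pi * n) x := fun x => by
    simpa using (hasDerivAt_id x).const_mul (Real.pi * (n : ℝ))
  have hs : ∀ x : ℝ, HasDerivAt (fun x : ℝ => (Real.sin (Real.pi * n * x) : ℂ))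
      ((Real.cos (Real.pi * n * x) * (Real.pi * n) : ℝ) : ℂ) x := fun x =>
    (hlin x).sin.ofReal_comp
  have hcos : ∀ x : ℝ, HasDerivAt (fun x : ℝ => (Real.cos (Real.pi * n * x) : ℂ))
      ((-Real.sin (Real.pi * n * x) * (Real.pi * n) : ℝ) : ℂ) x := fun x =>
    (hlin x).cos.ofReal_comp
  have e1 := intervalIntegral.integral_mul_deriv_eq_deriv_mul (a := 0) (b := 1)
    (fun x _ => hf x) (fun x _ => hcos x) (hcf'.intervalIntegrable _ _)
    ((by fun_prop : Continuous fun x : ℝ =>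
      ((-Real.sin (Real.pi * n * x) * (Real.pi * n) : ℝ) : ℂ)).intervalIntegrable _ _)
  have e2 := intervalIntegral.integral_mul_deriv_eq_deriv_mul (a := 0) (b := 1)
    (fun x _ => hf' x) (fun x _ => hs x) (hc.intervalIntegrable _ _)
    ((by fun_prop : Continuous fun x : ℝ =>
      ((Real.cos (Real.pi * n * x) * (Real.pi * n) : ℝ) : ℂ)).intervalIntegrable _ _)
  have hsin1 : Real.sin (Real.pi * n * 1) = 0 := by
    rw [mul_one, mul_comm]; exact Real.sin_int_mul_pi n
  have k1 : ∀ x : ℝ, f x * ((-Real.sin (Real.pi * n * x) * (Real.pi * n) : ℝ) : ℂ)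
      = (-((Real.pi * n : ℝ) : ℂ)) * (f x * (Real.sin (Real.pi * n * x) : ℂ)) := fun x => by
    push_cast; ring
  have k2 : ∀ x : ℝ, f' x * ((Real.cos (Real.pi * n * x) * (Real.pi * n) : ℝ) : ℂ)
      = (((Real.pi * n : ℝ) : ℂ)) * (f' x * (Real.cos (Real.pi * n * x) : ℂ)) := fun x => by
    push_cast; ring
  simp only [k1, intervalIntegral.integral_const_mul, h0, h1, zero_mul, sub_zero, zero_sub] at e1
  simp only [k2, intervalIntegral.integral_const_mul, hsin1, mul_zero, Real.sin_zero,
    Complex.ofReal_zero, sub_zero, zero_sub] at e2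
  unfold sineCoeff
  linear_combination (-((Real.pi * n : ℝ) : ℂ)) * e1 + e2

theorem norm_sineCoeff_le {f : ℝ → ℂ} {C : ℝ} (hC : ∀ x ∈ Icc (0:ℝ) 1, ‖f x‖ ≤ C) (n : ℤ) :
    ‖sineCoeff f n‖ ≤ C := by
  have := intervalIntegral.norm_integral_le_of_norm_le_const (a := (0:ℝ)) (b := 1) (C := C)
    (f := fun x => f x * (Real.sin (Real.pi * n * x) : ℂ)) (fun x hx => by
      rw [uIoc_of_le zero_le_one] at hx
      rw [norm_mul, Complex.norm_real, Real.norm_eq_abs]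
      exact (mul_le_of_le_one_right (norm_nonneg _) (Real.abs_sin_le_one _)).trans
        (hC x ⟨hx.1.le, hx.2⟩))
  simpa [sineCoeff] using this

theorem summable_sineCoeff {g : ℕ → ℝ → ℂ} (hg : ∀ j x, HasDerivAt (g j) (g (j + 1) x) x)
    (h0 : ∀ j, g (2 * j) 0 = 0) (h1 : ∀ j, g (2 * j) 1 = 0) (k : ℕ) :
    Summable fun n : ℤ => |(n : ℝ)| ^ k * ‖sineCoeff (g 0) n‖ := by
  have hcont : ∀ j, Continuous (g j) := fun j =>
    continuous_iff_continuousAt.2 fun x => (hg j x).continuousAt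
  have hit : ∀ (j : ℕ) (n : ℤ), (((Real.pi * n : ℝ) : ℂ) ^ 2) ^ j * sineCoeff (g 0) n
      = (-1) ^ j * sineCoeff (g (2 * j)) n := by
    intro j n
    induction j with
    | zero => simp
    | succ j ih =>
      have := sineCoeff_of_hasDerivAt (hg (2 * j)) (hg (2 * j + 1)) (hcont _) (h0 j) (h1 j) n
      rw [pow_succ, mul_right_comm, ih, show 2 * (j + 1) = 2 * j + 1 + 1 by ring, pow_succ]
      linear_combination (-1) ^ j * this
  obtain ⟨C, hC⟩ := isCompact_Icc.exists_bound_of_continuousOn (s := Icc (0:ℝ) 1)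
    (hcont (2 * (k + 1))).continuousOn
  refine Summable.of_nonneg_of_le (fun n => by positivity) (fun n => ?_)
    ((Real.summable_one_div_int_pow (p := 2)).2 one_lt_two |>.mul_left C)
  rcases eq_or_ne n 0 with rfl | hn
  · simp [sineCoeff]
  have hn1 : (1:ℝ) ≤ |(n : ℝ)| := by exact_mod_cast Int.one_le_abs hn
  have hb := congrArg norm (hit (k + 1) n)
  rw [norm_mul, norm_mul, norm_pow, norm_pow, norm_pow, norm_neg, norm_one, one_pow, one_mul,
    Complex.norm_real, Real.norm_eq_abs, abs_mul, abs_of_pos Real.pi_pos] at hb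
  have hle : ‖sineCoeff (g (2 * (k + 1))) n‖ ≤ C := norm_sineCoeff_le hC n
  have hpi : |(n : ℝ)| ≤ Real.pi * |(n : ℝ)| := by
    nlinarith [Real.pi_gt_three]
  have hpow : |(n : ℝ)| ^ (k + 2) ≤ ((Real.pi * |(n : ℝ)|) ^ 2) ^ (k + 1) := by
    calc |(n : ℝ)| ^ (k + 2) ≤ |(n : ℝ)| ^ (2 * (k + 1)) := pow_le_pow_right₀ hn1 (by omega)
      _ = (|(n : ℝ)| ^ 2) ^ (k + 1) := pow_mul _ _ _
      _ ≤ _ := by gcongr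
  have h2 : |(n : ℝ)| ^ (k + 2) * ‖sineCoeff (g 0) n‖ ≤ C :=
    (mul_le_mul_of_nonneg_right hpow (norm_nonneg _)).trans (hb.le.trans hle)
  rw [mul_one_div, le_div_iff₀ (by positivity), ← sq_abs]
  calc _ = |(n : ℝ)| ^ (k + 2) * ‖sineCoeff (g 0) n‖ := by ring
    _ ≤ C := h2

theorem hasSum_sineCoeff {f : ℝ → ℂ} (hf : Continuous f) (h0 : f 0 = 0) (h1 : f 1 = 0)
    (hsum : Summable (sineCoeff f)) {x : ℝ} (hx : x ∈ Ico (0:ℝ) 1) :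
    HasSum (fun n : ℤ => sineCoeff f n * (Real.sin (Real.pi * n * x) : ℂ)) (f x) := by
  have : Fact ((0:ℝ) < 2) := ⟨two_pos⟩
  let F : ℝ → ℂ := fun x => if 0 ≤ x then f x else -f (-x)
  have hF : Continuous F := Continuous.if_le hf (hf.comp continuous_neg).neg continuous_const
    continuous_id (fun x hx => by subst hx; simp [h0])
  have hFc : Continuous (AddCircle.liftIco 2 (-1) F) := by
    refine AddCircle.liftIco_continuous ?_ hF.continuousOn
    simp only [F]; norm_num [h1]
  have hcoef : ∀ n, fourierCoeff (AddCircle.liftIco 2 (-1) F) n = -Complex.I * sineCoeff f n := by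
    intro n
    rw [fourierCoeff_liftIco_eq, fourierCoeffOn_eq_integral]
    have hexp : ∀ (m : ℤ) (x : ℝ), fourier m (x : AddCircle ((-1 + 2 : ℝ) - (-1)))
        = Complex.exp (Complex.I * (Real.pi * m * x : ℝ)) := fun m x => by
      rw [fourier_coe_apply]; congr 1; push_cast; ring
    simp only [hexp]
    set G : ℝ → ℂ := fun x => Complex.exp (Complex.I * (Real.pi * (-n : ℤ) * x : ℝ)) • F x with hG
    have hGc : Continuous G := by
      have : Continuous fun x : ℝ => Complex.exp (Complex.I * (Real.pi * (-n : ℤ) * x : ℝ)) := by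
        fun_prop
      exact this.smul hF
    rw [show (-1 + 2 : ℝ) = 1 by norm_num, ← intervalIntegral.integral_add_adjacent_intervals
      (hGc.intervalIntegrable (-1) 0) (hGc.intervalIntegrable 0 1)]
    have hneg : ∫ x in (-1:ℝ)..0, G x = ∫ x in (0:ℝ)..1, G (-x) := by
      rw [intervalIntegral.integral_comp_neg]; simp
    have hGn : Continuous fun x => G (-x) := hGc.comp continuous_neg
    rw [hneg, ← intervalIntegral.integral_add
      (hGn.intervalIntegrable 0 1) (hGc.intervalIntegrable 0 1)]
    have hintegral : ∫ x in (0:ℝ)..1, (G (-x) + G x)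
        = ∫ x in (0:ℝ)..1, (-2 * Complex.I) * (f x * (Real.sin (Real.pi * n * x) : ℂ)) := by
      refine intervalIntegral.integral_congr fun x hx => ?_
      rw [uIcc_of_le zero_le_one] at hx
      have e1 : F x = f x := if_pos hx.1
      have e2 : F (-x) = -f x := by
        rcases hx.1.eq_or_lt with h | h
        · subst h; simp [F, h0]
        · simp [F, h]
      simp only [hG, e1, e2, smul_eq_mul]
      have a1 : Complex.I * ((Real.pi * ((-n : ℤ) : ℝ) * -x : ℝ) : ℂ)
          = ((Real.pi * n * x : ℝ) : ℂ) * Complex.I := by push_cast; ring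
      have a2 : Complex.I * ((Real.pi * ((-n : ℤ) : ℝ) * x : ℝ) : ℂ)
          = -((Real.pi * n * x : ℝ) : ℂ) * Complex.I := by push_cast; ring
      rw [a1, a2, Complex.exp_mul_I, Complex.exp_mul_I, Complex.cos_neg, Complex.sin_neg,
        Complex.ofReal_sin]
      ring
    rw [hintegral, intervalIntegral.integral_const_mul]
    simp only [sineCoeff, Complex.real_smul]
    push_cast; ring
  let FC : C(AddCircle (2:ℝ), ℂ) := ⟨_, hFc⟩
  have hco : fourierCoeff FC = fun n => -Complex.I * sineCoeff f n := funext hcoef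
  have hsF := has_pointwise_sum_fourier_series_of_summable (f := FC)
    (by rw [hco]; exact hsum.mul_left _) x
  have hval : FC x = f x := by
    change AddCircle.liftIco 2 (-1) F x = f x
    rw [AddCircle.liftIco_coe_apply ⟨by linarith [hx.1], by linarith [hx.2]⟩]
    exact if_pos hx.1
  have hodd : ∀ n : ℤ, sineCoeff f (-n) = -sineCoeff f n := fun n => by
    simp [sineCoeff, intervalIntegral.integral_neg]
  rw [hval, hco] at hsF
  have hsF2 := ((Equiv.neg ℤ).hasSum_iff.2 hsF)
  have := (hsF.add hsF2).div_const 2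
  rw [show (f x + f x) / 2 = f x by ring] at this
  refine this.congr_fun ?_
  intro n
  simp only [Function.comp, Equiv.neg_apply, hodd, smul_eq_mul, fourier_coe_apply]
  have a1 : 2 * (Real.pi : ℂ) * Complex.I * (n : ℂ) * (x : ℂ) / ((2:ℝ) : ℂ)
      = ((Real.pi * n * x : ℝ) : ℂ) * Complex.I := by push_cast; ring
  have a2 : 2 * (Real.pi : ℂ) * Complex.I * ((-n : ℤ) : ℂ) * (x : ℂ) / ((2:ℝ) : ℂ)
      = -((Real.pi * n * x : ℝ) : ℂ) * Complex.I := by push_cast; ring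
  rw [a1, a2, Complex.exp_mul_I, Complex.exp_mul_I, Complex.cos_neg, Complex.sin_neg,
        Complex.ofReal_sin]
  ring_nf
  simp

theorem exists_sine_series {g : ℕ → ℝ → ℂ} (hg : ∀ j x, HasDerivAt (g j) (g (j + 1) x) x)
    (h0 : ∀ j, g (2 * j) 0 = 0) (h1 : ∀ j, g (2 * j) 1 = 0) :
    ∃ b : ℤ → ℂ, (∀ k : ℕ, Summable fun n : ℤ => |(n : ℝ)| ^ k * ‖b n‖) ∧
      ∀ x ∈ Icc (0:ℝ) 1, ∑' n : ℤ, b n * (Real.sin (Real.pi * n * x) : ℂ) = g 0 x := by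
  refine ⟨sineCoeff (g 0), summable_sineCoeff hg h0 h1, fun x hx => ?_⟩
  rcases hx.2.eq_or_lt with rfl | hlt
  · rw [show g 0 1 = 0 from h1 0]
    have h : ∀ n : ℤ, Real.sin (Real.pi * n * 1) = 0 := fun n => by
      rw [mul_one, mul_comm]; exact Real.sin_int_mul_pi n
    simp only [h, Complex.ofReal_zero, mul_zero, tsum_zero]
  · refine (hasSum_sineCoeff (continuous_iff_continuousAt.2 fun x => (hg 0 x).continuousAt)
      (h0 0) (h1 0) (Summable.of_norm ?_) ⟨hx.1, hlt⟩).tsum_eq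
    simpa using summable_sineCoeff hg h0 h1 0

end SineSeries

section Cross

@[simp] theorem cross3_zero (a b : E3) : cross3 a b 0 = a 1 * b 2 - a 2 * b 1 := by
  simp [cross3, crossProduct]

@[simp] theorem cross3_one (a b : E3) : cross3 a b 1 = a 2 * b 0 - a 0 * b 2 := by
  simp [cross3, crossProduct]

@[simp] theorem cross3_two (a b : E3) : cross3 a b 2 = a 0 * b 1 - a 1 * b 0 := by
  simp [cross3, crossProduct]

theorem E3.ext_coord {a b : E3} (h0 : a 0 = b 0) (h1 : a 1 = b 1) (h2 : a 2 = b 2) : a = b := by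
  ext i; fin_cases i <;> assumption

theorem E3.inner_eq (a b : E3) : inner ℝ a b = a 0 * b 0 + a 1 * b 1 + a 2 * b 2 := by
  simp [PiLp.inner_apply, Fin.sum_univ_three, mul_comm]

/-- The cross product of `ℝ³` as a continuous bilinear map. -/
def crossL : E3 →L[ℝ] E3 →L[ℝ] E3 :=
  LinearMap.toContinuousLinearMap <|
    (LinearMap.toContinuousLinearMap : (E3 →ₗ[ℝ] E3) ≃ₗ[ℝ] E3 →L[ℝ] E3).toLinearMap ∘ₗ
    LinearMap.mk₂ ℝ cross3
    (fun a b c => by apply E3.ext_coord <;> simp <;> ring)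
    (fun r a b => by apply E3.ext_coord <;> simp <;> ring)
    (fun a b c => by apply E3.ext_coord <;> simp <;> ring)
    (fun r a b => by apply E3.ext_coord <;> simp <;> ring)

@[simp] theorem crossL_apply (a b : E3) : crossL a b = cross3 a b := rfl

theorem cross3_cross3 (a b c : E3) :
    cross3 a (cross3 b c) = inner ℝ a c • b - inner ℝ a b • c := by
  apply E3.ext_coord <;> simp [E3.inner_eq] <;> ring

theorem cross3_anticomm (a b : E3) : cross3 a b = -cross3 b a := by
  apply E3.ext_coord <;> simp <;> ring

theorem cross3_self (a : E3) : cross3 a a = 0 := by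
  apply E3.ext_coord <;> simp <;> ring

theorem inner_cross3_cyclic (a b c : E3) : inner ℝ a (cross3 b c) = inner ℝ c (cross3 a b) := by
  simp [E3.inner_eq]; ring

theorem inner_self_cross3 (a b : E3) : inner ℝ a (cross3 a b) = 0 := by
  simp [E3.inner_eq]; ring

theorem inner_cross3_self (a b : E3) : inner ℝ b (cross3 a b) = 0 := by
  simp [E3.inner_eq]; ring

theorem norm_cross3_le (a b : E3) : ‖cross3 a b‖ ≤ ‖a‖ * ‖b‖ := by
  refine abs_le_of_sq_le_sq' ?_ (by positivity) |>.2
  rw [mul_pow, ← real_inner_self_eq_norm_sq, ← real_inner_self_eq_norm_sq,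
    ← real_inner_self_eq_norm_sq]
  have : inner ℝ (cross3 a b) (cross3 a b) = inner ℝ a a * inner ℝ b b - inner ℝ a b ^ 2 := by
    simp only [E3.inner_eq, cross3_zero, cross3_one, cross3_two]; ring
  rw [this]; linarith [sq_nonneg (inner ℝ a b : ℝ)]

theorem HasDerivAt.cross3 {f g : ℝ → E3} {f' g' : E3} {x : ℝ} (hf : HasDerivAt f f' x)
    (hg : HasDerivAt g g' x) :
    HasDerivAt (fun y => cross3 (f y) (g y)) (cross3 f' (g x) + cross3 (f x) g') x := by
  have := (crossL.isBoundedBilinearMap.hasFDerivAt (f x, g x)).comp_hasDerivAt x (hf.prodMk hg)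
  refine (this.congr_deriv ?_)
  simp [add_comm]

theorem ContDiff.cross3 {F : Type*} [NormedAddCommGroup F] [NormedSpace ℝ F] {n : WithTop ℕ∞}
    {f g : F → E3} (hf : ContDiff ℝ n f) (hg : ContDiff ℝ n g) :
    ContDiff ℝ n fun y => cross3 (f y) (g y) :=
  crossL.isBoundedBilinearMap.contDiff.comp (hf.prodMk hg)

/-- Three vectors of `ℝ³` that multiply like the standard basis. -/
def IsCrossTriple (u e f : E3) : Prop := cross3 u e = f ∧ cross3 e f = u ∧ cross3 f u = e

namespace IsCrossTriple

variable {u e f : E3}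

theorem inner_eq_zero (h : IsCrossTriple u e f) :
    inner ℝ u e = 0 ∧ inner ℝ u f = 0 ∧ inner ℝ e f = 0 := by
  refine ⟨?_, ?_, ?_⟩
  · rw [← h.2.2]; exact inner_cross3_self _ _
  · rw [← h.1]; exact inner_self_cross3 _ _
  · rw [← h.1]; exact inner_cross3_self _ _

theorem inner_self_eq (h : IsCrossTriple u e f) :
    inner ℝ e e = inner ℝ u u ∧ inner ℝ f f = inner ℝ u u := by
  have h1 : inner ℝ e e = inner ℝ u u := by
    nth_rewrite 2 [← h.2.2]
    rw [inner_cross3_cyclic, h.2.1]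
  refine ⟨h1, ?_⟩
  nth_rewrite 2 [← h.1]
  rw [inner_cross3_cyclic, h.2.2, h1]

end IsCrossTriple

end Cross

section Frame

theorem hasDerivAt_unique_of_eqOn_Icc {F : Type*} [NormedAddCommGroup F] [NormedSpace ℝ F]
    {f g : ℝ → F} {f' g' : F} {a b x : ℝ} (hab : a < b) (hx : x ∈ Icc a b)
    (hfg : EqOn f g (Icc a b)) (hf : HasDerivAt f f' x) (hg : HasDerivAt g g' x) : f' = g' :=
  (uniqueDiffOn_Icc hab x hx).eq_deriv _ hf.hasDerivWithinAt
    (hg.hasDerivWithinAt.congr hfg (hfg hx))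

theorem eq_of_hasDerivAt_zero_Icc {F : Type*} [NormedAddCommGroup F] [NormedSpace ℝ F]
    {f : ℝ → F} {a b : ℝ} (hf : ∀ x ∈ Icc a b, HasDerivAt f 0 x) {x : ℝ} (hx : x ∈ Icc a b) :
    f x = f a :=
  constant_of_has_deriv_right_zero (fun y hy => (hf y hy).continuousAt.continuousWithinAt)
    (fun y hy => (hf y ⟨hy.1, hy.2.le⟩).hasDerivWithinAt) x hx

theorem exists_unit_inner_eq_zero {u : E3} (hu : ‖u‖ = 1) :
    ∃ e : E3, ‖e‖ = 1 ∧ inner ℝ e u = 0 := by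
  have key : ∃ w : E3, cross3 u w ≠ 0 := by
    by_contra! h
    have h0 := h (!₂[1, 0, 0])
    have h1 := h (!₂[0, 1, 0])
    have a0 := congrArg (fun v : E3 => v 0) h1
    have a1 := congrArg (fun v : E3 => v 1) h0
    have a2 := congrArg (fun v : E3 => v 2) h0
    have a3 := congrArg (fun v : E3 => v 2) h1
    simp at a0 a1 a2 a3
    have : u = 0 := E3.ext_coord a3 a2 a0
    simp [this] at hu
  obtain ⟨w, hw⟩ := key
  refine ⟨‖cross3 u w‖⁻¹ • cross3 u w, ?_, ?_⟩
  · rw [norm_smul, norm_inv, norm_norm, inv_mul_cancel₀ (norm_ne_zero_iff.2 hw)]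
  · rw [real_inner_smul_left, real_inner_comm, inner_self_cross3, mul_zero]

theorem exists_parallel_field {u₀ : ℝ → E3} (hsm : ContDiff ℝ (⊤ : ℕ∞) u₀) (e₀ : E3) :
    ∃ e : ℝ → E3, e 0 = e₀ ∧ ContDiff ℝ (⊤ : ℕ∞) e ∧
      ∀ x, HasDerivAt e (-(inner ℝ (deriv u₀ x) (e x) • u₀ x)) x := by
  have hd : ContDiff ℝ (⊤ : ℕ∞) (deriv u₀) := (contDiff_infty_iff_deriv.1 hsm).2
  obtain ⟨e, h0, he⟩ := linearODE_exists
    (A := fun x => -((innerSL ℝ (deriv u₀ x)).smulRight (u₀ x)))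
    (by
      have h1 : Continuous fun x => innerSL ℝ (deriv u₀ x) :=
        (innerSL ℝ).continuous.comp hd.continuous
      have h2 := hsm.continuous
      fun_prop) e₀
  have he' : ∀ x, HasDerivAt e (-(inner ℝ (deriv u₀ x) (e x) • u₀ x)) x := fun x =>
    (he x).congr_deriv (by simp)
  refine ⟨e, h0, ?_, he'⟩
  refine contDiff_infty.2 fun n => ?_
  have hdiff : Differentiable ℝ e := fun x => (he' x).differentiableAt
  have hder : deriv e = fun x => -(inner ℝ (deriv u₀ x) (e x) • u₀ x) :=
    funext fun x => (he' x).deriv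
  induction n with
  | zero => exact contDiff_zero.2 hdiff.continuous
  | succ n ih =>
    push_cast
    refine contDiff_succ_iff_deriv.2 ⟨hdiff, by simp, ?_⟩
    rw [hder]
    have a := hd.of_le (m := n) (by exact_mod_cast le_top)
    have b := hsm.of_le (m := n) (by exact_mod_cast le_top)
    exact ((a.inner ℝ ih).smul b).neg

theorem exists_frame {u₀ : ℝ → E3} (hsm : ContDiff ℝ (⊤ : ℕ∞) u₀)
    (hsph : ∀ x ∈ Icc (0:ℝ) 1, ‖u₀ x‖ = 1) :
    ∃ (e f : ℝ → E3) (q r : ℝ → ℝ), ContDiff ℝ (⊤ : ℕ∞) q ∧ ContDiff ℝ (⊤ : ℕ∞) r ∧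
      ∀ x ∈ Icc (0:ℝ) 1, IsCrossTriple (u₀ x) (e x) (f x) ∧
        HasDerivAt u₀ (q x • e x + r x • f x) x ∧
        HasDerivAt e (-(q x • u₀ x)) x ∧ HasDerivAt f (-(r x • u₀ x)) x := by
  have hd : ContDiff ℝ (⊤ : ℕ∞) (deriv u₀) := (contDiff_infty_iff_deriv.1 hsm).2
  have hu' : ∀ x, HasDerivAt u₀ (deriv u₀ x) x := fun x =>
    (hsm.differentiable (by simp) x).hasDerivAt
  obtain ⟨e₀, he₀, hperp⟩ := exists_unit_inner_eq_zero (hsph 0 (by simp))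
  obtain ⟨e, h0, hesm, he⟩ := exists_parallel_field hsm e₀
  have huu : ∀ x ∈ Icc (0:ℝ) 1, inner ℝ (u₀ x) (u₀ x) = (1 : ℝ) := fun x hx => by
    rw [real_inner_self_eq_norm_sq, hsph x hx, one_pow]
  have huu' : ∀ x ∈ Icc (0:ℝ) 1, inner ℝ (deriv u₀ x) (u₀ x) = (0 : ℝ) := fun x hx => by
    have h := hasDerivAt_unique_of_eqOn_Icc zero_lt_one hx huu ((hu' x).inner ℝ (hu' x))
      (hasDerivAt_const x (1:ℝ))
    rw [real_inner_comm] at h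
    linarith
  have heu : ∀ x ∈ Icc (0:ℝ) 1, inner ℝ (e x) (u₀ x) = (0 : ℝ) := fun x hx => by
    rw [eq_of_hasDerivAt_zero_Icc (f := fun x => (inner ℝ (e x) (u₀ x) : ℝ)) (fun y hy => ?_) hx,
      h0,
      hperp]
    refine ((he y).inner ℝ (hu' y)).congr_deriv ?_
    rw [inner_neg_left, real_inner_smul_left, huu y hy, real_inner_comm (deriv u₀ y)]
    ring
  have hee : ∀ x ∈ Icc (0:ℝ) 1, inner ℝ (e x) (e x) = (1 : ℝ) := fun x hx => by
    rw [eq_of_hasDerivAt_zero_Icc (f := fun x => (inner ℝ (e x) (e x) : ℝ)) (fun y hy => ?_) hx,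
      h0,
      real_inner_self_eq_norm_sq, he₀, one_pow]
    refine ((he y).inner ℝ (he y)).congr_deriv ?_
    rw [inner_neg_left, inner_neg_right, real_inner_smul_left, real_inner_smul_right, heu y hy,
      real_inner_comm (e y) (u₀ y), heu y hy]
    ring
  have hfsm := hsm.cross3 hesm
  refine ⟨e, fun x => cross3 (u₀ x) (e x), fun x => inner ℝ (deriv u₀ x) (e x),
    fun x => inner ℝ (deriv u₀ x) (cross3 (u₀ x) (e x)), hd.inner ℝ hesm, hd.inner ℝ hfsm,
    fun x hx => ?_⟩
  have hef : cross3 (e x) (cross3 (u₀ x) (e x)) = u₀ x := by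
    rw [cross3_cross3, hee x hx, heu x hx, one_smul, zero_smul, sub_zero]
  have hfu : cross3 (cross3 (u₀ x) (e x)) (u₀ x) = e x := by
    rw [cross3_anticomm, cross3_cross3, huu x hx, real_inner_comm, heu x hx]
    simp
  refine ⟨⟨rfl, hef, hfu⟩, ?_, he x, ?_⟩
  · refine (hu' x).congr_deriv ?_
    have h1 : cross3 (u₀ x) (cross3 (deriv u₀ x) (u₀ x)) = deriv u₀ x := by
      rw [cross3_cross3, huu x hx, real_inner_comm, huu' x hx]; simp
    have h2 : cross3 (deriv u₀ x) (u₀ x) =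
        inner ℝ (deriv u₀ x) (cross3 (u₀ x) (e x)) • e x -
          inner ℝ (deriv u₀ x) (e x) • cross3 (u₀ x) (e x) := by
      conv_lhs => rw [← hef]
      rw [cross3_cross3]
    conv_lhs => rw [← h1, h2]
    have h3 : cross3 (u₀ x) (cross3 (u₀ x) (e x)) = - e x := by
      rw [cross3_anticomm, hfu]
    rw [← crossL_apply (u₀ x), map_sub, map_smul, map_smul, crossL_apply, crossL_apply, h3]
    module
  · refine ((hu' x).cross3 (he x)).congr_deriv ?_
    have h1 : cross3 (deriv u₀ x) (e x) =
        -(inner ℝ (deriv u₀ x) (cross3 (u₀ x) (e x)) • u₀ x) := by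
      conv_lhs => rw [← hfu]
      rw [cross3_cross3, huu' x hx]; simp
    have h2 : cross3 (u₀ x) (-(inner ℝ (deriv u₀ x) (e x) • u₀ x)) = 0 := by
      rw [← crossL_apply, map_neg, map_smul, crossL_apply, cross3_self, smul_zero, neg_zero]
    rw [h1, h2, add_zero]

theorem ContDiff.hasDerivAt_iteratedDeriv {q : ℝ → ℝ} (hq : ContDiff ℝ (⊤ : ℕ∞) q) (j : ℕ)
    (x : ℝ) : HasDerivAt (iteratedDeriv j q) (iteratedDeriv (j + 1) q x) x := by
  rw [iteratedDeriv_succ]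
  exact (hq.differentiable_iteratedDeriv j (by exact_mod_cast ENat.natCast_lt_top j) x).hasDerivAt

theorem covIter_contDiff {u₀ : ℝ → E3} (hsm : ContDiff ℝ (⊤ : ℕ∞) u₀) (j : ℕ) :
    ContDiff ℝ (⊤ : ℕ∞) (covIter u₀ j) := by
  induction j with
  | zero => exact (contDiff_infty_iff_deriv.1 hsm).2
  | succ j ih =>
    have hd := (contDiff_infty_iff_deriv.1 ih).2
    exact hd.sub ((hd.inner ℝ hsm).smul hsm)

theorem covIter_eq {u₀ e f : ℝ → E3} {q r : ℝ → ℝ} (hsm : ContDiff ℝ (⊤ : ℕ∞) u₀)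
    (hsph : ∀ x ∈ Icc (0:ℝ) 1, ‖u₀ x‖ = 1)
    (hq : ContDiff ℝ (⊤ : ℕ∞) q) (hr : ContDiff ℝ (⊤ : ℕ∞) r)
    (h : ∀ x ∈ Icc (0:ℝ) 1, IsCrossTriple (u₀ x) (e x) (f x) ∧
        HasDerivAt u₀ (q x • e x + r x • f x) x ∧
        HasDerivAt e (-(q x • u₀ x)) x ∧ HasDerivAt f (-(r x • u₀ x)) x) (j : ℕ) :
    ∀ x ∈ Icc (0:ℝ) 1, covIter u₀ j x = iteratedDeriv j q x • e x + iteratedDeriv j r x • f x := by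
  induction j with
  | zero =>
    intro x hx
    simpa [covIter] using (h x hx).2.1.deriv
  | succ j ih =>
    intro x hx
    obtain ⟨ht, hu, he, hf⟩ := h x hx
    have hW := ((hq.hasDerivAt_iteratedDeriv j x).smul he).add
      ((hr.hasDerivAt_iteratedDeriv j x).smul hf)
    have hC : HasDerivAt (covIter u₀ j) (deriv (covIter u₀ j) x) x :=
      ((covIter_contDiff hsm j).differentiable (by simp) x).hasDerivAt
    have hE := hasDerivAt_unique_of_eqOn_Icc zero_lt_one hx ih hC hW
    obtain ⟨i1, i2, -⟩ := ht.inner_eq_zero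
    have huu : inner ℝ (u₀ x) (u₀ x) = (1 : ℝ) := by
      rw [real_inner_self_eq_norm_sq, hsph x hx, one_pow]
    have hin : inner ℝ (deriv (covIter u₀ j) x) (u₀ x)
        = -(iteratedDeriv j q x * q x + iteratedDeriv j r x * r x) := by
      rw [hE, real_inner_comm]
      simp only [inner_add_right, inner_smul_right, inner_neg_right, i1, i2, huu]
      ring
    change deriv (covIter u₀ j) x - (inner ℝ (deriv (covIter u₀ j) x) (u₀ x) : ℝ) • u₀ x = _
    rw [hin, hE]
    module

theorem exists_frame_of_compatible {u₀ : ℝ → E3} (hsm : ContDiff ℝ (⊤ : ℕ∞) u₀)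
    (hsph : ∀ x ∈ Icc (0:ℝ) 1, ‖u₀ x‖ = 1) (hcc : ∀ k, CC u₀ k) :
    ∃ (e f : ℝ → E3) (g : ℕ → ℝ → ℂ), (∀ j x, HasDerivAt (g j) (g (j + 1) x) x) ∧
      (∀ j, g (2 * j) 0 = 0) ∧ (∀ j, g (2 * j) 1 = 0) ∧
      ∀ x ∈ Icc (0:ℝ) 1, IsCrossTriple (u₀ x) (e x) (f x) ∧
        HasDerivAt u₀ ((g 0 x).re • e x + (g 0 x).im • f x) x ∧
        HasDerivAt e (-((g 0 x).re • u₀ x)) x ∧ HasDerivAt f (-((g 0 x).im • u₀ x)) x := by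
  obtain ⟨e, f, q, r, hq, hr, h⟩ := exists_frame hsm hsph
  have hz : ∀ x ∈ Icc (0:ℝ) 1, ∀ j, covIter u₀ (2 * j) x = 0 →
      iteratedDeriv (2 * j) q x = 0 ∧ iteratedDeriv (2 * j) r x = 0 := by
    intro x hx j h0
    rw [covIter_eq hsm hsph hq hr h (2 * j) x hx] at h0
    obtain ⟨ht, -⟩ := h x hx
    obtain ⟨-, -, i3⟩ := ht.inner_eq_zero
    obtain ⟨n1, n2⟩ := ht.inner_self_eq
    have huu : inner ℝ (u₀ x) (u₀ x) = (1 : ℝ) := by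
      rw [real_inner_self_eq_norm_sq, hsph x hx, one_pow]
    have a := congrArg (fun v => (inner ℝ (e x) v : ℝ)) h0
    have b := congrArg (fun v => (inner ℝ (f x) v : ℝ)) h0
    simp only [inner_add_right, inner_smul_right, inner_zero_right, n1, n2, huu, i3,
      real_inner_comm (e x) (f x), mul_one, mul_zero, add_zero, zero_add] at a b
    exact ⟨a, b⟩
  refine ⟨e, f, fun j x =>
      ((iteratedDeriv j q x : ℝ) : ℂ) + ((iteratedDeriv j r x : ℝ) : ℂ) * Complex.I,
    fun j x => ?_, fun j => ?_, fun j => ?_, ?_⟩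
  · exact (hq.hasDerivAt_iteratedDeriv j x).ofReal_comp.add
      ((hr.hasDerivAt_iteratedDeriv j x).ofReal_comp.mul_const _)
  · obtain ⟨a, b⟩ := hz 0 (by simp) j (hcc j j le_rfl).1
    simp [a, b]
  · obtain ⟨a, b⟩ := hz 1 (by simp) j (hcc j j le_rfl).2
    simp [a, b]
  · simpa using h

end Frame

section Partials

variable {u : ℝ → ℝ → E3}

theorem hasDerivAt_fst (hu : ContDiff ℝ (⊤ : ℕ∞) fun p : ℝ × ℝ => u p.1 p.2) (x t : ℝ) :
    HasDerivAt (fun y => u y t) (fderiv ℝ (fun p : ℝ × ℝ => u p.1 p.2) (x, t) (1, 0)) x :=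
  HasFDerivAt.comp_hasDerivAt (f := fun y => (y, t)) x
    (hu.differentiable (by simp) (x, t)).hasFDerivAt
    ((hasDerivAt_id' x).prodMk (hasDerivAt_const x t))

theorem hasDerivAt_snd (hu : ContDiff ℝ (⊤ : ℕ∞) fun p : ℝ × ℝ => u p.1 p.2) (x t : ℝ) :
    HasDerivAt (fun s => u x s) (fderiv ℝ (fun p : ℝ × ℝ => u p.1 p.2) (x, t) (0, 1)) t :=
  HasFDerivAt.comp_hasDerivAt (f := fun s => (x, s)) t
    (hu.differentiable (by simp) (x, t)).hasFDerivAt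
    ((hasDerivAt_const t x).prodMk (hasDerivAt_id' t))

theorem pdx_eq_fderiv (hu : ContDiff ℝ (⊤ : ℕ∞) fun p : ℝ × ℝ => u p.1 p.2) :
    (fun p : ℝ × ℝ => pdx u p.1 p.2) = fun p => fderiv ℝ (fun p : ℝ × ℝ => u p.1 p.2) p (1, 0) :=
  funext fun p => (hasDerivAt_fst hu p.1 p.2).deriv

theorem pdt_eq_fderiv (hu : ContDiff ℝ (⊤ : ℕ∞) fun p : ℝ × ℝ => u p.1 p.2) :
    (fun p : ℝ × ℝ => pdt u p.1 p.2) = fun p => fderiv ℝ (fun p : ℝ × ℝ => u p.1 p.2) p (0, 1) :=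
  funext fun p => (hasDerivAt_snd hu p.1 p.2).deriv

theorem hasDerivAt_pdx (hu : ContDiff ℝ (⊤ : ℕ∞) fun p : ℝ × ℝ => u p.1 p.2) (x t : ℝ) :
    HasDerivAt (fun y => u y t) (pdx u x t) x :=
  (hasDerivAt_fst hu x t).differentiableAt.hasDerivAt

theorem hasDerivAt_pdt (hu : ContDiff ℝ (⊤ : ℕ∞) fun p : ℝ × ℝ => u p.1 p.2) (x t : ℝ) :
    HasDerivAt (fun s => u x s) (pdt u x t) t :=
  (hasDerivAt_snd hu x t).differentiableAt.hasDerivAt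

theorem contDiff_pdx (hu : ContDiff ℝ (⊤ : ℕ∞) fun p : ℝ × ℝ => u p.1 p.2) :
    ContDiff ℝ (⊤ : ℕ∞) fun p : ℝ × ℝ => pdx u p.1 p.2 := by
  rw [pdx_eq_fderiv hu]
  exact (hu.fderiv_right (by simp)).clm_apply contDiff_const

theorem contDiff_pdt (hu : ContDiff ℝ (⊤ : ℕ∞) fun p : ℝ × ℝ => u p.1 p.2) :
    ContDiff ℝ (⊤ : ℕ∞) fun p : ℝ × ℝ => pdt u p.1 p.2 := by
  rw [pdt_eq_fderiv hu]
  exact (hu.fderiv_right (by simp)).clm_apply contDiff_const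

theorem pdt_pdx_comm (hu : ContDiff ℝ (⊤ : ℕ∞) fun p : ℝ × ℝ => u p.1 p.2) (x t : ℝ) :
    pdt (pdx u) x t = pdx (pdt u) x t := by
  have hd : DifferentiableAt ℝ (fderiv ℝ fun p : ℝ × ℝ => u p.1 p.2) (x, t) :=
    (hu.fderiv_right (m := (⊤ : ℕ∞)) (by simp)).differentiable (by simp) _
  have h1 := congrFun (pdt_eq_fderiv (contDiff_pdx hu)) (x, t)
  have h2 := congrFun (pdx_eq_fderiv (contDiff_pdt hu)) (x, t)
  simp only at h1 h2
  rw [h1, h2, pdx_eq_fderiv hu, pdt_eq_fderiv hu, fderiv_clm_apply hd (differentiableAt_const _),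
    fderiv_clm_apply hd (differentiableAt_const _)]
  have hs := (hu.contDiffAt (x := (x, t))).isSymmSndFDerivAt
    (by simpa using WithTop.coe_le_coe.2 (le_top : (2 : ℕ∞) ≤ ⊤))
  simpa using hs (0, 1) (1, 0)

end Partials

section Uniqueness

theorem hasDerivAt_integral_of_continuous {e e' : ℝ → ℝ → ℝ}
    (he : Continuous fun p : ℝ × ℝ => e p.1 p.2) (he' : Continuous fun p : ℝ × ℝ => e' p.1 p.2)
    (hd : ∀ x t, HasDerivAt (fun s => e x s) (e' x t) t) (t : ℝ) :
    HasDerivAt (fun s => ∫ x in (0:ℝ)..1, e x s) (∫ x in (0:ℝ)..1, e' x t) t := by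
  obtain ⟨C, hC⟩ := (isCompact_Icc.prod isCompact_Icc).exists_bound_of_continuousOn
    (s := Icc (0:ℝ) 1 ×ˢ Icc (t - 1) (t + 1)) he'.continuousOn
  have hc : ∀ s, Continuous fun x => e x s := fun s =>
    he.comp (continuous_id.prodMk continuous_const)
  have hc' : ∀ s, Continuous fun x => e' x s := fun s =>
    he'.comp (continuous_id.prodMk continuous_const)
  refine (intervalIntegral.hasDerivAt_integral_of_dominated_loc_of_deriv_le
    (F := fun s x => e x s) (F' := fun s x => e' x s) (bound := fun _ => C)
    (Icc_mem_nhds (a := t - 1) (b := t + 1) (by linarith) (by linarith))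
    (Filter.Eventually.of_forall fun s => (hc s).aestronglyMeasurable)
    ((hc t).intervalIntegrable _ _) (hc' t).aestronglyMeasurable
    (Filter.Eventually.of_forall fun x hx s hs => ?_) intervalIntegrable_const
    (Filter.Eventually.of_forall fun x _ s _ => hd x s)).2
  rw [uIoc_of_le zero_le_one] at hx
  exact hC (x, s) ⟨⟨hx.1.le, hx.2⟩, hs⟩

theorem energy_identity {w wt wx wxx wxt v vx a b : E3}
    (h : wt = cross3 w a + cross3 v wxx) :
    2 * inner ℝ w wt + 2 * inner ℝ wx wxt =
      (2 * (inner ℝ w (cross3 vx wx + cross3 v wxx) + inner ℝ wx (cross3 v wx)) +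
        2 * (inner ℝ wx wxt + inner ℝ wxx wt) -
        2 * (inner ℝ wx (cross3 wx a + cross3 w b) + inner ℝ wxx (cross3 w a))) +
      (-2 * inner ℝ w (cross3 vx wx) + 2 * inner ℝ wx (cross3 w b) : ℝ) := by
  subst h
  simp only [E3.inner_eq, PiLp.add_apply, cross3_zero, cross3_one, cross3_two]
  ring

theorem IsSol.unique {T : ℝ} {u v : ℝ → ℝ → E3} (hu : IsSol T u) (hv : IsSol T v)
    (h0 : ∀ x ∈ Icc (0:ℝ) 1, u x 0 = v x 0) :
    ∀ x ∈ Icc (0:ℝ) 1, ∀ t ∈ Icc (0:ℝ) T, u x t = v x t := by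
  obtain ⟨us, -, ueq, ubc⟩ := hu
  obtain ⟨vs, -, veq, vbc⟩ := hv
  set w : ℝ → ℝ → E3 := fun x t => u x t - v x t with hw
  have ws : ContDiff ℝ (⊤ : ℕ∞) fun p : ℝ × ℝ => w p.1 p.2 := us.sub vs
  have wxe : pdx w = fun x t => pdx u x t - pdx v x t := by
    funext x t; exact ((hasDerivAt_pdx us x t).sub (hasDerivAt_pdx vs x t)).deriv
  have uxs := contDiff_pdx us
  have vxs := contDiff_pdx vs
  have wxs := contDiff_pdx ws
  have uxxs := contDiff_pdx uxs
  have wts := contDiff_pdt ws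
  have uxxxs := contDiff_pdx uxxs
  have wxxe : ∀ x t, pdx (pdx w) x t = pdx (pdx u) x t - pdx (pdx v) x t := by
    intro x t; rw [wxe]; exact ((hasDerivAt_pdx uxs x t).sub (hasDerivAt_pdx vxs x t)).deriv
  have weq : ∀ x ∈ Icc (0:ℝ) 1, ∀ t ∈ Icc (0:ℝ) T,
      pdt w x t = cross3 (w x t) (pdx (pdx u) x t) + cross3 (v x t) (pdx (pdx w) x t) := by
    intro x hx t ht
    have h1 : pdt w x t = pdt u x t - pdt v x t :=
      ((hasDerivAt_pdt us x t).sub (hasDerivAt_pdt vs x t)).deriv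
    rw [h1, ueq x hx t ht, veq x hx t ht, wxxe]
    simp only [hw, ← crossL_apply, map_sub, sub_apply]
    abel
  have wbc : ∀ t ∈ Icc (0:ℝ) T, pdx w 0 t = 0 ∧ pdx w 1 t = 0 := fun t ht => by
    simp [wxe, ubc t ht, vbc t ht]
  let e : ℝ → ℝ → ℝ := fun x t => inner ℝ (w x t) (w x t) + inner ℝ (pdx w x t) (pdx w x t)
  let e' : ℝ → ℝ → ℝ := fun x t =>
    2 * inner ℝ (w x t) (pdt w x t) + 2 * inner ℝ (pdx w x t) (pdx (pdt w) x t)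
  let R : ℝ → ℝ → ℝ := fun x t => -2 * inner ℝ (w x t) (cross3 (pdx v x t) (pdx w x t)) +
    2 * inner ℝ (pdx w x t) (cross3 (w x t) (pdx (pdx (pdx u)) x t))
  let φ : ℝ → ℝ → ℝ := fun x t => 2 * inner ℝ (w x t) (cross3 (v x t) (pdx w x t)) +
    2 * inner ℝ (pdx w x t) (pdt w x t) -
    2 * inner ℝ (pdx w x t) (cross3 (w x t) (pdx (pdx u) x t))
  have hec : Continuous fun p : ℝ × ℝ => e p.1 p.2 :=
    ((ws.inner ℝ ws).add (wxs.inner ℝ wxs)).continuous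
  have he'c : Continuous fun p : ℝ × ℝ => e' p.1 p.2 :=
    ((contDiff_const.mul (ws.inner ℝ wts)).add
      (contDiff_const.mul (wxs.inner ℝ (contDiff_pdx wts)))).continuous
  have hRc : Continuous fun p : ℝ × ℝ => R p.1 p.2 :=
    ((contDiff_const.mul (ws.inner ℝ (vxs.cross3 wxs))).add
      (contDiff_const.mul (wxs.inner ℝ (ws.cross3 uxxxs)))).continuous
  have hed : ∀ x t, HasDerivAt (fun s => e x s) (e' x t) t := fun x t => by
    have h1 := hasDerivAt_pdt ws x t
    have h2 := hasDerivAt_pdt wxs x t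
    refine ((h1.inner ℝ h1).add (h2.inner ℝ h2)).congr_deriv ?_
    simp only [e', pdt_pdx_comm ws]
    rw [real_inner_comm (w x t) (pdt w x t), real_inner_comm (pdx w x t) (pdx (pdt w) x t)]
    ring
  have hE := hasDerivAt_integral_of_continuous hec he'c hed
  have hslice : ∀ {f : ℝ → ℝ → ℝ}, (Continuous fun p : ℝ × ℝ => f p.1 p.2) →
      ∀ t, Continuous fun x => f x t := fun hf t => hf.comp (continuous_id.prodMk continuous_const)
  have hintegral : ∀ t ∈ Icc (0:ℝ) T, ∫ x in (0:ℝ)..1, e' x t = ∫ x in (0:ℝ)..1, R x t := by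
    intro t ht
    have hφ : ∀ x ∈ uIcc (0:ℝ) 1, HasDerivAt (fun y => φ y t) (e' x t - R x t) x := by
      intro x hx
      rw [uIcc_of_le zero_le_one] at hx
      have dw := hasDerivAt_pdx ws x t
      have dv := hasDerivAt_pdx vs x t
      have dwx := hasDerivAt_pdx wxs x t
      have dwt := hasDerivAt_pdx wts x t
      have duxx := hasDerivAt_pdx uxxs x t
      have := (((dw.inner ℝ (dv.cross3 dwx)).const_mul 2).add
        ((dwx.inner ℝ dwt).const_mul 2)).sub ((dwx.inner ℝ (dw.cross3 duxx)).const_mul 2)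
      refine this.congr_deriv ?_
      rw [eq_sub_iff_add_eq]
      exact (energy_identity (weq x hx t ht)).symm
    have := intervalIntegral.integral_eq_sub_of_hasDerivAt hφ
      (((hslice he'c t).sub (hslice hRc t)).intervalIntegrable _ _)
    have z : φ 1 t - φ 0 t = 0 := by
      simp only [φ, wbc t ht, ← crossL_apply, map_zero, inner_zero_left, inner_zero_right]
      simp
    rw [z, intervalIntegral.integral_sub ((hslice he'c t).intervalIntegrable _ _)
      ((hslice hRc t).intervalIntegrable _ _)] at this
    linarith
  obtain ⟨C, hC⟩ := (isCompact_Icc.prod isCompact_Icc).exists_bound_of_continuousOn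
    (s := Icc (0:ℝ) 1 ×ˢ Icc 0 T) vxs.continuous.continuousOn
  obtain ⟨D, hD⟩ := (isCompact_Icc.prod isCompact_Icc).exists_bound_of_continuousOn
    (s := Icc (0:ℝ) 1 ×ˢ Icc 0 T) uxxxs.continuous.continuousOn
  have he0 : ∀ x t, 0 ≤ e x t := fun x t => add_nonneg real_inner_self_nonneg real_inner_self_nonneg
  have hRb : ∀ x ∈ Icc (0:ℝ) 1, ∀ t ∈ Icc (0:ℝ) T, ‖R x t‖ ≤ (C + D) * e x t := by
    intro x hx t ht
    have c := hC (x, t) ⟨hx, ht⟩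
    have d := hD (x, t) ⟨hx, ht⟩
    simp only at c d
    have r1 : |inner ℝ (w x t) (cross3 (pdx v x t) (pdx w x t))| ≤ ‖w x t‖ * (C * ‖pdx w x t‖) :=
      (abs_real_inner_le_norm _ _).trans (by gcongr; exact (norm_cross3_le _ _).trans (by gcongr))
    have r2 : |inner ℝ (pdx w x t) (cross3 (w x t) (pdx (pdx (pdx u)) x t))|
        ≤ ‖pdx w x t‖ * (‖w x t‖ * D) :=
      (abs_real_inner_le_norm _ _).trans (by gcongr; exact (norm_cross3_le _ _).trans (by gcongr))
    have r3 : ‖R x t‖ ≤ 2 * |inner ℝ (w x t) (cross3 (pdx v x t) (pdx w x t))| +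
        2 * |inner ℝ (pdx w x t) (cross3 (w x t) (pdx (pdx (pdx u)) x t))| := by
      refine (norm_add_le _ _).trans ?_
      simp [Real.norm_eq_abs]
    simp only [e, real_inner_self_eq_norm_sq]
    have hCD : 0 ≤ C + D := add_nonneg ((norm_nonneg _).trans c) ((norm_nonneg _).trans d)
    nlinarith [mul_nonneg hCD (sq_nonneg (‖w x t‖ - ‖pdx w x t‖))]
  have hbound : ∀ t ∈ Ico (0:ℝ) T, ‖∫ x in (0:ℝ)..1, e' x t‖
      ≤ (C + D) * ‖∫ x in (0:ℝ)..1, e x t‖ + 0 := by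
    intro t ht
    have ht' : t ∈ Icc (0:ℝ) T := ⟨ht.1, ht.2.le⟩
    rw [hintegral t ht', add_zero, Real.norm_of_nonneg
      (intervalIntegral.integral_nonneg zero_le_one fun x _ => he0 x t),
      ← intervalIntegral.integral_const_mul]
    exact intervalIntegral.norm_integral_le_of_norm_le zero_le_one
      (Filter.Eventually.of_forall fun x hx => hRb x ⟨hx.1.le, hx.2⟩ t ht')
      (((hslice hec t).const_mul _).intervalIntegrable _ _)
  have hinit : ∀ x ∈ Icc (0:ℝ) 1, e x 0 = 0 := by
    intro x hx
    have a : ∀ y ∈ Icc (0:ℝ) 1, w y 0 = 0 := fun y hy => sub_eq_zero.2 (h0 y hy)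
    have b : pdx w x 0 = 0 := hasDerivAt_unique_of_eqOn_Icc zero_lt_one hx a
      (hasDerivAt_pdx ws x 0) (hasDerivAt_const x (0:E3))
    simp [e, a x hx, b]
  have hE0 : ‖∫ x in (0:ℝ)..1, e x 0‖ ≤ 0 := by
    rw [intervalIntegral.integral_congr (g := fun _ => (0:ℝ)) fun x hx => hinit x (by
      rwa [uIcc_of_le zero_le_one] at hx)]
    simp
  intro x hx t ht
  have hz := norm_le_gronwallBound_of_norm_deriv_right_le
    (fun s _ => (hE s).continuousAt.continuousWithinAt) (fun s _ => (hE s).hasDerivWithinAt)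
    hE0 hbound t ht
  rw [gronwallBound_ε0, zero_mul, norm_le_zero_iff] at hz
  by_contra hne
  have hpos : 0 < ∫ x in (0:ℝ)..1, e x t := by
    refine intervalIntegral.integral_pos zero_lt_one (hslice hec t).continuousOn
      (fun x _ => he0 x t) ⟨x, hx, ?_⟩
    have : 0 < inner ℝ (w x t) (w x t) := real_inner_self_pos.2 (sub_ne_zero.2 hne)
    exact add_pos_of_pos_of_nonneg this real_inner_self_nonneg
  exact hpos.ne' hz

end Uniqueness

section Assembly

theorem eq_zero_of_linear_Icc {E : Type*} [NormedAddCommGroup E] [NormedSpace ℝ E]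
    {A : ℝ → E →L[ℝ] E} {d : ℝ → E} {a b : ℝ} (hA : ContinuousOn A (Icc a b))
    (hd : ∀ x ∈ Icc a b, HasDerivAt d (A x (d x)) x) (h0 : d a = 0) :
    ∀ x ∈ Icc a b, d x = 0 := by
  intro x hx
  obtain ⟨K, hK⟩ := isCompact_Icc.exists_bound_of_continuousOn hA
  have := norm_le_gronwallBound_of_norm_deriv_right_le (δ := 0) (K := K) (ε := 0)
    (fun y hy => (hd y hy).continuousAt.continuousWithinAt)
    (fun y hy => (hd y ⟨hy.1, hy.2.le⟩).hasDerivWithinAt) (by simp [h0])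
    (fun y hy => by
      rw [add_zero]
      exact ((A y).le_opNorm _).trans (by gcongr; exact hK y ⟨hy.1, hy.2.le⟩)) x hx
  rwa [gronwallBound_ε0, zero_mul, norm_le_zero_iff] at this

/-- The infinitesimal rotation of a frame `(u, e, f)` of `ℝ³` that moves `u` with velocity
`p • e + r • f` and rotates `e` into `f` with velocity `a`. -/
def frameGen (p r a : ℝ) : E3 × E3 × E3 →L[ℝ] E3 × E3 × E3 :=
  let U := ContinuousLinearMap.fst ℝ E3 (E3 × E3)
  let V := (ContinuousLinearMap.fst ℝ E3 E3).comp (ContinuousLinearMap.snd ℝ E3 (E3 × E3))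
  let W := (ContinuousLinearMap.snd ℝ E3 E3).comp (ContinuousLinearMap.snd ℝ E3 (E3 × E3))
  p • V.prod ((-U).prod 0) + r • W.prod ((0 : E3 × E3 × E3 →L[ℝ] E3).prod (-U)) +
    a • (0 : E3 × E3 × E3 →L[ℝ] E3).prod (W.prod (-V))

theorem frameGen_apply (p r a : ℝ) (Y : E3 × E3 × E3) : frameGen p r a Y =
    (p • Y.2.1 + r • Y.2.2, -(p • Y.1) + a • Y.2.2, -(r • Y.1) - a • Y.2.1) := by
  simp [frameGen, sub_eq_add_neg]

theorem contDiffOn_frameGen {s : Set (ℝ × ℝ)} {p r a : ℝ × ℝ → ℝ}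
    (hp : ContDiffOn ℝ (⊤ : ℕ∞) p s) (hr : ContDiffOn ℝ (⊤ : ℕ∞) r s)
    (ha : ContDiffOn ℝ (⊤ : ℕ∞) a s) :
    ContDiffOn ℝ (⊤ : ℕ∞) (fun z => frameGen (p z) (r z) (a z)) s :=
  ((hp.smul contDiffOn_const).add (hr.smul contDiffOn_const)).add (ha.smul contDiffOn_const)

theorem hasDerivAt_frameGen {p r a : ℝ → ℝ} {p' r' a' t : ℝ} (hp : HasDerivAt p p' t)
    (hr : HasDerivAt r r' t) (ha : HasDerivAt a a' t) :
    HasDerivAt (fun s => frameGen (p s) (r s) (a s)) (frameGen p' r' a') t := by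
  have hM : ∀ {k : ℝ → ℝ} {k' : ℝ}, HasDerivAt k k' t →
      ∀ M : E3 × E3 × E3 →L[ℝ] E3 × E3 × E3, HasDerivAt (fun s => k s • M) (k' • M) t :=
    fun hk M => hk.smul_const M
  exact ((hM hp _).add (hM hr _)).add (hM ha _)

theorem frameGen_flat {q₁ q₂ p₁ p₂ a q₁' q₂' p₁' p₂' a' : ℝ} (h₁ : q₁' - a * q₂ = p₁')
    (h₂ : q₂' + a * q₁ = p₂') (h₃ : a' = p₁ * q₂ - q₁ * p₂) :
    frameGen q₁' q₂' 0 + (frameGen q₁ q₂ 0).comp (frameGen p₁ p₂ a) =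
      frameGen p₁' p₂' a' + (frameGen p₁ p₂ a).comp (frameGen q₁ q₂ 0) := by
  subst h₁ h₂ h₃
  refine ContinuousLinearMap.ext fun Y => ?_
  simp only [add_apply, ContinuousLinearMap.comp_apply, frameGen_apply, Prod.mk_add_mk]
  refine Prod.ext ?_ (Prod.ext ?_ ?_) <;> simp only <;> module

/-- The failure of a triple of vectors to multiply like the standard basis of `ℝ³`. -/
def crossDefect (Y : E3 × E3 × E3) : E3 × E3 × E3 :=
  (cross3 Y.2.1 Y.2.2 - Y.1, cross3 Y.2.2 Y.1 - Y.2.1, cross3 Y.1 Y.2.1 - Y.2.2)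

theorem crossDefect_eq_zero {Y : E3 × E3 × E3} :
    crossDefect Y = 0 ↔ IsCrossTriple Y.1 Y.2.1 Y.2.2 := by
  simp only [crossDefect, IsCrossTriple, Prod.mk_eq_zero, sub_eq_zero]
  tauto

theorem hasDerivAt_crossDefect {Y : ℝ → E3 × E3 × E3} {p r a t : ℝ}
    (hY : HasDerivAt Y (frameGen p r a (Y t)) t) :
    HasDerivAt (fun s => crossDefect (Y s)) (frameGen p r a (crossDefect (Y t))) t := by
  rw [frameGen_apply] at hY
  have h1 : HasDerivAt (fun s => (Y s).1) _ t := hY.fst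
  have h2 : HasDerivAt (fun s => (Y s).2.1) _ t := hY.snd.fst
  have h3 : HasDerivAt (fun s => (Y s).2.2) _ t := hY.snd.snd
  refine (((h2.cross3 h3).sub h1).prodMk
    (((h3.cross3 h1).sub h2).prodMk ((h1.cross3 h2).sub h3))).congr_deriv ?_
  simp only [frameGen_apply, crossDefect]
  refine Prod.ext ?_ (Prod.ext ?_ ?_) <;> apply E3.ext_coord <;> simp <;> ring

theorem exists_smooth_cutoff {S : ℝ} (hS : 0 < S) : ∃ φ : ℝ → ℝ, ContDiff ℝ (⊤ : ℕ∞) φ ∧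
    (∀ t, φ t ∈ Ioo (-S) S) ∧ ∀ t ∈ Ioo (-(S / 2)) (S / 2), φ t = t := by
  let ψ : ContDiffBump (0 : ℝ) := ⟨S / 2, 3 / 4 * S, by positivity, by linarith⟩
  refine ⟨fun t => ψ t * t, ψ.contDiff.mul contDiff_id, fun t => ?_, fun t ht => ?_⟩
  · change ψ t * t ∈ Ioo (-S) S
    rw [mem_Ioo, ← abs_lt, abs_mul, abs_of_nonneg (ψ.nonneg)]
    rcases lt_or_ge |t| (3 / 4 * S) with h | h
    · calc ψ t * |t| ≤ 1 * |t| := by gcongr; exact ψ.le_one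
        _ < S := by linarith
    · rw [ψ.zero_of_le_dist (by simpa [Real.dist_eq] using h), zero_mul]; exact hS
  · have : ψ t = 1 := ψ.one_of_mem_closedBall (by
      rw [mem_closedBall_zero_iff, Real.norm_eq_abs]; exact (abs_lt.2 ht).le)
    change ψ t * t = t
    rw [this, one_mul]

theorem exists_flow_of_nls {u₀ e f : ℝ → E3} {g : ℝ → ℂ} {T : ℝ} (hT : 0 < T)
    {q q₁ q₂ : ℝ × ℝ → ℂ} (hq : ContDiffOn ℝ (⊤ : ℕ∞) q (univ ×ˢ Ioo (-T) T))
    (hq₁ : ContDiffOn ℝ (⊤ : ℕ∞) q₁ (univ ×ˢ Ioo (-T) T))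
    (hq₂ : ContDiffOn ℝ (⊤ : ℕ∞) q₂ (univ ×ˢ Ioo (-T) T))
    (hqx : ∀ p : ℝ × ℝ, HasDerivAt (fun x => q (x, p.2)) (q₁ p) p.1)
    (hqxx : ∀ p : ℝ × ℝ, HasDerivAt (fun x => q₁ (x, p.2)) (q₂ p) p.1)
    (hqt : ∀ p ∈ (univ ×ˢ Ioo (-T) T : Set (ℝ × ℝ)), HasDerivAt (fun t => q (p.1, t))
        (Complex.I * q₂ p + Complex.I / 2 * (q p * star (q p) * q p)) p.2)
    (hbc : ∀ t, q (0, t) = 0 ∧ q (1, t) = 0) (hinit : ∀ x ∈ Icc (0:ℝ) 1, q (x, 0) = g x)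
    (hsph : ∀ x ∈ Icc (0:ℝ) 1, ‖u₀ x‖ = 1)
    (hframe : ∀ x ∈ Icc (0:ℝ) 1, IsCrossTriple (u₀ x) (e x) (f x) ∧
        HasDerivAt u₀ ((g x).re • e x + (g x).im • f x) x ∧
        HasDerivAt e (-((g x).re • u₀ x)) x ∧ HasDerivAt f (-((g x).im • u₀ x)) x) :
    ∃ T₁ > 0, ∃ u : ℝ → ℝ → E3, IsSol T₁ u ∧ ∀ x ∈ Icc (0:ℝ) 1, u x 0 = u₀ x := by
  have hre : ∀ {z : ℝ → ℂ} {z' : ℂ} {t : ℝ}, HasDerivAt z z' t →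
      HasDerivAt (fun s => (z s).re) z'.re t := fun h =>
    Complex.reCLM.hasFDerivAt.comp_hasDerivAt _ h
  have him : ∀ {z : ℝ → ℂ} {z' : ℂ} {t : ℝ}, HasDerivAt z z' t →
      HasDerivAt (fun s => (z s).im) z'.im t := fun h =>
    Complex.imCLM.hasFDerivAt.comp_hasDerivAt _ h
  have hreC : ∀ {z : ℝ × ℝ → ℂ} {s : Set (ℝ × ℝ)}, ContDiffOn ℝ (⊤ : ℕ∞) z s →
      ContDiffOn ℝ (⊤ : ℕ∞) (fun p => (z p).re) s := fun h =>
    Complex.reCLM.contDiff.comp_contDiffOn h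
  have himC : ∀ {z : ℝ × ℝ → ℂ} {s : Set (ℝ × ℝ)}, ContDiffOn ℝ (⊤ : ℕ∞) z s →
      ContDiffOn ℝ (⊤ : ℕ∞) (fun p => (z p).im) s := fun h =>
    Complex.imCLM.contDiff.comp_contDiffOn h
  let a : ℝ × ℝ → ℝ := fun p => -(1 / 2) * ((q p).re * (q p).re + (q p).im * (q p).im)
  let a' : ℝ × ℝ → ℝ := fun p => -((q p).re * (q₁ p).re + (q p).im * (q₁ p).im)
  have ha : ContDiffOn ℝ (⊤ : ℕ∞) a (univ ×ˢ Ioo (-T) T) :=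
    contDiffOn_const.mul (((hreC hq).mul (hreC hq)).add ((himC hq).mul (himC hq)))
  have ha' : ContDiffOn ℝ (⊤ : ℕ∞) a' (univ ×ˢ Ioo (-T) T) :=
    (((hreC hq).mul (hreC hq₁)).add ((himC hq).mul (himC hq₁))).neg
  have hax : ∀ p : ℝ × ℝ, HasDerivAt (fun x => a (x, p.2)) (a' p) p.1 := fun p => by
    have h1 := hre (hqx p)
    have h2 := him (hqx p)
    refine (((h1.mul h1).add (h2.mul h2)).const_mul (-(1 / 2))).congr_deriv ?_
    simp only [a']
    ring
  set c : ℝ × ℝ → ℂ := fun p => Complex.I * q₂ p + Complex.I / 2 * (q p * star (q p) * q p)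
  have hcre : ∀ p, (c p).re = -(q₂ p).im + a p * (q p).im := fun p => by
    simp [c, a]; ring
  have hcim : ∀ p, (c p).im = (q₂ p).re - a p * (q p).re := fun p => by
    simp [c, a]; ring
  let A : ℝ × ℝ → E3 × E3 × E3 →L[ℝ] E3 × E3 × E3 := fun p => frameGen (q p).re (q p).im 0
  let B : ℝ × ℝ → E3 × E3 × E3 →L[ℝ] E3 × E3 × E3 := fun p =>
    frameGen (-(q₁ p).im) (q₁ p).re (a p)
  have hA : ContDiffOn ℝ (⊤ : ℕ∞) A (univ ×ˢ Ioo (-T) T) :=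
    contDiffOn_frameGen (hreC hq) (himC hq) contDiffOn_const
  have hB : ContDiffOn ℝ (⊤ : ℕ∞) B (univ ×ˢ Ioo (-T) T) :=
    contDiffOn_frameGen (himC hq₁).neg (hreC hq₁) ha
  obtain ⟨Y, hY0, hYs, hYx, hYt⟩ := exists_parallel_of_flat (S := T / 2) (by linarith)
    (by linarith) hA hB
    (At := fun p => frameGen (c p).re (c p).im 0)
    (Bx := fun p => frameGen (-(q₂ p).im) (q₂ p).re (a' p))
    (contDiffOn_frameGen (himC hq₂).neg (hreC hq₂) ha').continuousOn
    (fun p hp => hasDerivAt_frameGen (hre (hqt p hp)) (him (hqt p hp)) (hasDerivAt_const _ _))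
    (fun p _ => hasDerivAt_frameGen (him (hqxx p)).fun_neg (hre (hqxx p)) (hax p))
    (fun p _ => frameGen_flat (by rw [hcre]; ring) (by rw [hcim]; ring)
      (by simp only [a']; ring)) (u₀ 0, e 0, f 0)
  have hAc : ∀ {t : ℝ}, t ∈ Ioo (-T) T → Continuous fun x => A (x, t) := fun {t} ht =>
    continuousOn_univ.1 (hA.continuousOn.comp (f := fun x : ℝ => (x, t)) (by fun_prop)
      fun x _ => ⟨trivial, ht⟩)
  have hstart : ∀ x ∈ Icc (0:ℝ) 1, Y (x, 0) = (u₀ x, e x, f x) := by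
    intro x hx
    rw [← sub_eq_zero]
    refine eq_zero_of_linear_Icc (A := fun x => A (x, 0))
      (d := fun x => Y (x, 0) - (u₀ x, e x, f x))
      (hAc ⟨by linarith, hT⟩).continuousOn (fun y hy => ?_) (by simp [hY0]) x hx
    obtain ⟨-, d1, d2, d3⟩ := hframe y hy
    have hYy := hYx (y, 0) ⟨trivial, by simp; linarith, by simp; linarith⟩
    refine (hYy.sub (d1.prodMk (d2.prodMk d3))).congr_deriv ?_
    rw [map_sub]
    simp only [A, hinit y hy, frameGen_apply (g y).re (g y).im 0 (u₀ y, e y, f y)]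
    simp
  obtain ⟨φ, hφs, hφm, hφ⟩ := exists_smooth_cutoff (S := T / 2) (by linarith)
  have hstrip : ∀ {t : ℝ}, t ∈ Icc 0 (T / 8) → t ∈ Ioo (-(T / 2)) (T / 2) := fun ht =>
    ⟨by linarith [ht.1], by linarith [ht.2]⟩
  have hφI : ∀ {t : ℝ}, t ∈ Icc 0 (T / 8) → φ t = t := fun ht =>
    hφ _ ⟨by linarith [ht.1], by linarith [ht.2]⟩
  have htriple : ∀ x ∈ Icc (0:ℝ) 1, ∀ t ∈ Icc (0:ℝ) (T / 8),
      IsCrossTriple (Y (x, t)).1 (Y (x, t)).2.1 (Y (x, t)).2.2 := by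
    intro x hx t ht
    rw [← crossDefect_eq_zero]
    have hBc : ContinuousOn (fun t => B (x, t)) (Icc 0 (T / 8)) :=
      hB.continuousOn.comp (by fun_prop) fun s hs =>
        ⟨trivial, by linarith [hs.1], by linarith [hs.2]⟩
    refine eq_zero_of_linear_Icc hBc (d := fun t => crossDefect (Y (x, t)))
      (fun s hs => hasDerivAt_crossDefect (hYt (x, s) ⟨trivial, hstrip hs⟩)) ?_ t ht
    change crossDefect (Y (x, 0)) = 0
    rw [hstart x hx, crossDefect_eq_zero]
    exact (hframe x hx).1
  have hYtd : ∀ x, ∀ t ∈ Icc (0:ℝ) (T / 8), HasDerivAt (fun s => (Y (x, s)).1)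
      (-(q₁ (x, t)).im • (Y (x, t)).2.1 + (q₁ (x, t)).re • (Y (x, t)).2.2) t := fun x t ht => by
    have h := hYt (x, t) ⟨trivial, hstrip ht⟩
    simp only [B, frameGen_apply] at h
    exact h.fst
  have hYxd : ∀ (x t : ℝ), HasDerivAt (fun y => Y (y, φ t)) (A (x, φ t) (Y (x, φ t))) x :=
    fun x t => hYx (x, φ t) ⟨trivial, hφm t⟩
  let u : ℝ → ℝ → E3 := fun x t => (Y (x, φ t)).1
  have hux : pdx u = fun x t =>
      (q (x, φ t)).re • (Y (x, φ t)).2.1 + (q (x, φ t)).im • (Y (x, φ t)).2.2 := by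
    funext x t
    have h := hYxd x t
    simp only [A, frameGen_apply] at h
    have h1 : HasDerivAt (fun y => (Y (y, φ t)).1) _ x := h.fst
    exact h1.deriv
  refine ⟨T / 8, by positivity, u, ⟨?_, ?_, ?_, ?_⟩, fun x hx => ?_⟩
  · have : ContDiff ℝ (⊤ : ℕ∞) fun p : ℝ × ℝ => Y (p.1, φ p.2) :=
      hYs.comp_contDiff (contDiff_fst.prodMk (hφs.comp contDiff_snd)) fun p => ⟨trivial, hφm _⟩
    exact this.fst
  · intro x hx t ht
    have hconst := eq_of_hasDerivAt_zero_Icc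
      (f := fun s => (inner ℝ (Y (x, s)).1 (Y (x, s)).1 : ℝ)) (fun s hs => by
        have h := hYtd x s hs
        refine (h.inner ℝ h).congr_deriv ?_
        obtain ⟨i1, i2, -⟩ := (htriple x hx s hs).inner_eq_zero
        have hz : inner ℝ (Y (x, s)).1
            (-(q₁ (x, s)).im • (Y (x, s)).2.1 + (q₁ (x, s)).re • (Y (x, s)).2.2) = 0 := by
          rw [inner_add_right, inner_smul_right, inner_smul_right, i1, i2]
          simp
        rw [hz, real_inner_comm, hz, add_zero]) ht
    simp only [hstart x hx, real_inner_self_eq_norm_sq, hsph x hx, one_pow] at hconst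
    simp only [u, hφI ht]
    exact (pow_eq_one_iff_of_nonneg (norm_nonneg _) two_ne_zero).1 hconst
  · intro x hx t ht
    have hev : (fun s => u x s) =ᶠ[nhds t] fun s => (Y (x, s)).1 := by
      filter_upwards [Ioo_mem_nhds (a := -(T / 2 / 2)) (b := T / 2 / 2) (by linarith [ht.1])
        (by linarith [ht.2])] with s hs
      simp only [u, hφ s hs]
    have hut : pdt u x t = _ := ((hYtd x t ht).congr_of_eventuallyEq hev).deriv
    have huxx : pdx (pdx u) x t = (q₁ (x, t)).re • (Y (x, t)).2.1 + (q₁ (x, t)).im • (Y (x, t)).2.2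
        - ((q (x, t)).re ^ 2 + (q (x, t)).im ^ 2) • (Y (x, t)).1 := by
      rw [hux]
      have h := hYxd x t
      simp only [A, frameGen_apply] at h
      have h1 := hre (hqx (x, φ t))
      have h2 := him (hqx (x, φ t))
      refine ((h1.smul h.snd.fst).add (h2.smul h.snd.snd)).deriv.trans ?_
      simp only [hφI ht]
      module
    obtain ⟨t1, t2, t3⟩ := htriple x hx t ht
    have t3' : cross3 (Y (x, t)).1 (Y (x, t)).2.2 = -(Y (x, t)).2.1 := by
      rw [cross3_anticomm, t3]
    rw [hut, huxx]
    simp only [u, hφI ht]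
    rw [← crossL_apply, map_sub, map_add, map_smul, map_smul, map_smul, crossL_apply, crossL_apply,
      crossL_apply, t1, t3', cross3_self]
    module
  · intro t ht
    simp [hux, (hbc (φ t)).1, (hbc (φ t)).2]
  · simp only [u, hφI (t := 0) ⟨le_rfl, by positivity⟩, hstart x hx]

end Assembly

theorem local_existence_uniqueness_smooth_schrodinger_flow
    (u₀ : ℝ → E3) (hsm : ContDiff ℝ (⊤ : ℕ∞) u₀)
    (hsph : ∀ x ∈ Icc (0:ℝ) 1, ‖u₀ x‖ = 1)
    (hcc : ∀ k : ℕ, CC u₀ k) :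
    ∃ T₁ > (0:ℝ), ∃ u : ℝ → ℝ → E3,
      (IsSol T₁ u ∧ ∀ x ∈ Icc (0:ℝ) 1, u x 0 = u₀ x) ∧
      ∀ v : ℝ → ℝ → E3, (IsSol T₁ v ∧ ∀ x ∈ Icc (0:ℝ) 1, v x 0 = u₀ x) →
        ∀ x ∈ Icc (0:ℝ) 1, ∀ t ∈ Icc (0:ℝ) T₁, v x t = u x t := by
  obtain ⟨e, f, g, hg, g0, g1, hframe⟩ := exists_frame_of_compatible hsm hsph hcc
  obtain ⟨b, hb, hsum⟩ := exists_sine_series hg g0 g1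
  obtain ⟨T, hT, q, q₁, q₂, hq, hq₁, hq₂, hqx, hqxx, hqt, hbc, hinit⟩ := exists_nls_solution hb
  obtain ⟨T₁, hT₁, u, hu, hu0⟩ := exists_flow_of_nls hT hq hq₁ hq₂ hqx hqxx hqt hbc
    (fun x hx => (hinit x).trans (hsum x hx)) hsph hframe
  exact ⟨T₁, hT₁, u, ⟨hu, hu0⟩, fun v hv =>
    hv.1.unique hu fun x hx => (hv.2 x hx).trans (hu0 x hx).symm⟩

end
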